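/- Multi-period First Fundamental Theorem without options (Theorem 4.5): The following are equivalent: (i) NA(𝒫) holds; (ii) for every t ∈ {0,…,T−1}, the set N_t := {ω ∈ Ω_t : NA(𝒫_t(ω)) fails} is 𝒫-polar; (iii) for every P ∈ 𝒫 there exists Q ∈ 𝒬 such that P ≪ Q. -/

import Mathlib

open MeasureTheory Set Filter Topology
open scoped ENNReal NNReal

noncomputable section

namespace BN

/-- The universal completion of the ambient measurable structure on `α`:
a set is measurable iff it is null-measurable for every probability measure. -/
def univComp (α : Type*) [MeasurableSpace α] : MeasurableSpace α where
  MeasurableSet' s := ∀ μ : Measure α, IsProbabilityMeasure μ → NullMeasurableSet s μ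
  measurableSet_empty := fun _ _ => MeasurableSet.empty.nullMeasurableSet
  measurableSet_compl := fun _ hs μ hμ => (hs μ hμ).compl
  measurableSet_iUnion := fun _ hf μ hμ => NullMeasurableSet.iUnion fun i => hf i μ hμ

/-- `N` is `PP`-polar: it is contained in an `m`-measurable set which is null under
every `P ∈ PP`. -/
def IsPolar {α : Type*} [MeasurableSpace α] (PP : Set (Measure α)) (m : MeasurableSpace α)
    (N : Set α) : Prop :=
  ∃ A : Set α, MeasurableSet[m] A ∧ N ⊆ A ∧ ∀ P ∈ PP, P A = 0

/-- A property holds `PP`-quasi surely if its complement is `PP`-polar. -/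
def QuasiSure {α : Type*} [mα : MeasurableSpace α] (PP : Set (Measure α))
    (m : MeasurableSpace α) (p : α → Prop) : Prop :=
  @IsPolar α mα PP m {ω | ¬ p ω}

/-- Expectation of a real random variable, with the convention
`E[f] = E[f⁺] - E[f⁻]` and `∞ - ∞ = -∞` (which holds in `EReal`). -/
def expec {α : Type*} [MeasurableSpace α] (Q : Measure α) (f : α → ℝ) : EReal :=
  ((∫⁻ x, ENNReal.ofReal (f x) ∂Q : ℝ≥0∞) : EReal)
    - ((∫⁻ x, ENNReal.ofReal (-f x) ∂Q : ℝ≥0∞) : EReal)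

/-- Positive part of an extended real, valued in `ℝ≥0∞`. -/
def posE (x : EReal) : ℝ≥0∞ := if x = ⊤ then ⊤ else ENNReal.ofReal x.toReal

/-- Expectation of an extended-real random variable, with the convention
`E[f] = E[f⁺] - E[f⁻]` and `∞ - ∞ = -∞`. -/
def eexpec {α : Type*} [MeasurableSpace α] (Q : Measure α) (f : α → EReal) : EReal :=
  ((∫⁻ x, posE (f x) ∂Q : ℝ≥0∞) : EReal) - ((∫⁻ x, posE (-(f x)) ∂Q : ℝ≥0∞) : EReal)

/-- A real-valued function is upper semianalytic if all its strict superlevel sets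
are analytic. -/
def UpperSemianalytic {α : Type*} [TopologicalSpace α] (f : α → ℝ) : Prop :=
  ∀ c : ℝ, AnalyticSet {x | c < f x}

/-- An extended-real-valued function is upper semianalytic if all its strict
superlevel sets `{f > c}`, `c ∈ ℝ`, are analytic. -/
def UpperSemianalyticE {α : Type*} [TopologicalSpace α] (f : α → EReal) : Prop :=
  ∀ c : ℝ, AnalyticSet {x | (c : EReal) < f x}

/-- Convexity of a set of probability measures. -/
def ConvexPM {α : Type*} [MeasurableSpace α] (C : Set (ProbabilityMeasure α)) : Prop :=
  ∀ μ ∈ C, ∀ ν ∈ C, ∀ a b : ℝ≥0∞, a + b = 1 →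
    ∀ ξ : ProbabilityMeasure α, (ξ : Measure α) = a • (μ : Measure α) + b • (ν : Measure α) →
      ξ ∈ C

/-! ### The general (non-Polish) setting of Section 2 -/

section General

variable {Ω : Type*} [MeasurableSpace Ω]

/-- Predictability of a trading strategy `H` with respect to a filtration `F`:
the holding `H (u+1)` over the period `(u, u+1]` is `F u`-measurable. -/
def PredictableF (F : ℕ → MeasurableSpace Ω) (T d : ℕ) (H : ℕ → Ω → Fin d → ℝ) : Prop :=
  ∀ u : ℕ, u < T → Measurable[F u] (H (u + 1))

/-- The final gain `(H · S)_T` from trading `H` in the stocks `S`. -/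
def gainF {d : ℕ} (S : ℕ → Ω → Fin d → ℝ) (H : ℕ → Ω → Fin d → ℝ) (T : ℕ) (ω : Ω) : ℝ :=
  ∑ u : Fin T, ∑ i : Fin d, H (u + 1) ω i * (S (u + 1) ω i - S u ω i)

/-- The no-arbitrage condition `NA(PP)` (no options). -/
def NAF (F : ℕ → MeasurableSpace Ω) (T d : ℕ) (S : ℕ → Ω → Fin d → ℝ)
    (PP : Set (Measure Ω)) : Prop :=
  ∀ H : ℕ → Ω → Fin d → ℝ, PredictableF F T d H →
    QuasiSure PP ‹MeasurableSpace Ω› (fun ω => 0 ≤ gainF S H T ω) →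
      QuasiSure PP ‹MeasurableSpace Ω› (fun ω => gainF S H T ω = 0)

/-- The cone `𝒞` of claims superreplicable from zero initial capital. -/
def Cset (F : ℕ → MeasurableSpace Ω) (T d : ℕ) (S : ℕ → Ω → Fin d → ℝ) : Set (Ω → ℝ) :=
  {W | ∃ H : ℕ → Ω → Fin d → ℝ, PredictableF F T d H ∧
    ∃ K : Ω → ℝ, Measurable K ∧ (∀ ω, 0 ≤ K ω) ∧ ∀ ω, W ω = gainF S H T ω - K ω}

/-- The superhedging price (no options), with values in `EReal` (`inf ∅ = +∞`). -/
def superPriceF (F : ℕ → MeasurableSpace Ω) (T d : ℕ) (S : ℕ → Ω → Fin d → ℝ)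
    (PP : Set (Measure Ω)) (f : Ω → ℝ) : EReal :=
  sInf ((fun x : ℝ => (x : EReal)) ''
    {x : ℝ | ∃ H : ℕ → Ω → Fin d → ℝ, PredictableF F T d H ∧
      QuasiSure PP ‹MeasurableSpace Ω› (fun ω => f ω ≤ x + gainF S H T ω)})

end General

/-! ### The one-period setting of Section 3 -/

section OnePeriod

variable {Ω : Type*} [MeasurableSpace Ω] {d : ℕ}

/-- One-period no-arbitrage condition `NA(PP)` for the increment `ΔS`. -/
def NA1 (PP : Set (Measure Ω)) (ΔS : Ω → Fin d → ℝ) : Prop :=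
  ∀ y : Fin d → ℝ,
    QuasiSure PP ‹MeasurableSpace Ω› (fun ω => 0 ≤ ∑ i, y i * ΔS ω i) →
      QuasiSure PP ‹MeasurableSpace Ω› (fun ω => ∑ i, y i * ΔS ω i = 0)

/-- The martingale measures dominated by `PP` in the one-period market:
`𝒬 = {Q : Q ⋘ 𝒫, E_Q[ΔS] = 0}`. -/
def Q1set (PP : Set (Measure Ω)) (ΔS : Ω → Fin d → ℝ) : Set (Measure Ω) :=
  {Q | IsProbabilityMeasure Q ∧ (∃ P ∈ PP, Q ≪ P) ∧
    ∀ i, expec Q (fun ω => ΔS ω i) = 0}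

/-- One-period superhedging price, with values in `EReal` (`inf ∅ = +∞`). -/
def superPrice1 (PP : Set (Measure Ω)) (ΔS : Ω → Fin d → ℝ) (f : Ω → ℝ) : EReal :=
  sInf ((fun x : ℝ => (x : EReal)) ''
    {x : ℝ | ∃ H : Fin d → ℝ,
      QuasiSure PP ‹MeasurableSpace Ω› (fun ω => f ω ≤ x + ∑ i, H i * ΔS ω i)})

end OnePeriod

/-! ### The Polish multi-period setting -/

section Polish

variable (Ω₁ : Type) [MeasurableSpace Ω₁]

/-- Restriction of a path up to time `t`. -/
def restr {T : ℕ} (t : ℕ) (h : t ≤ T) (ω : Fin T → Ω₁) : Fin t → Ω₁ :=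
  fun i => ω (Fin.castLE h i)

/-- Universally measurable predictability: `H u` (the holding over `(u, u+1]`)
is a universally measurable function of the first `u` coordinates. -/
def Pred (d : ℕ) (H : (u : ℕ) → (Fin u → Ω₁) → Fin d → ℝ) : Prop :=
  ∀ u : ℕ, @Measurable _ _ (univComp (Fin u → Ω₁)) _ (H u)

/-- The gain `(H · S)_t = ∑_{u=1}^t H_u (S_u - S_{u-1})` up to time `t ≤ T`. -/
def gain {T d : ℕ} (S : (t : ℕ) → (Fin t → Ω₁) → Fin d → ℝ)
    (H : (u : ℕ) → (Fin u → Ω₁) → Fin d → ℝ) (t : ℕ) (h : t ≤ T) (ω : Fin T → Ω₁) : ℝ :=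
  ∑ u : Fin t, ∑ i : Fin d,
    H u (restr Ω₁ u (u.2.le.trans h) ω) i *
      (S (u + 1) (restr Ω₁ (u + 1) (Nat.succ_le_of_lt (u.2.trans_le h)) ω) i
        - S u (restr Ω₁ u (u.2.le.trans h) ω) i)

variable [TopologicalSpace Ω₁] [OpensMeasurableSpace Ω₁]

/-- The set `PP = {P₀ ⊗ ⋯ ⊗ P_{t-1}}` of measures built from universally
measurable selectors of the one-step collections `𝒫_s(·)`. -/
def MeasFam (Pt : (t : ℕ) → (Fin t → Ω₁) → Set (ProbabilityMeasure Ω₁)) :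
    (t : ℕ) → Set (Measure (Fin t → Ω₁))
  | 0 => {μ | μ = Measure.dirac Fin.elim0}
  | (t + 1) => {μ | ∃ ν ∈ MeasFam Pt t, ∃ κ : (Fin t → Ω₁) → ProbabilityMeasure Ω₁,
      @Measurable _ _ (univComp (Fin t → Ω₁)) (borel (ProbabilityMeasure Ω₁)) κ ∧
      (∀ ω, κ ω ∈ Pt t ω) ∧
      μ = ν.bind (fun ω => Measure.map (Fin.snoc ω) (κ ω : Measure Ω₁))}

/-- The σ-field `ℱ_t` on `Ω = Ω₁^T`: the comap under the restriction map of the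
universal completion of the Borel σ-field of `Ω₁^t`. -/
def filtr (T : ℕ) (t : ℕ) (h : t ≤ T) : MeasurableSpace (Fin T → Ω₁) :=
  MeasurableSpace.comap (restr Ω₁ t h) (univComp (Fin t → Ω₁))

/-- `S` is a `Q`-martingale with respect to the filtration `(ℱ_t)`. -/
def IsMartMeas {T d : ℕ} (S : (t : ℕ) → (Fin t → Ω₁) → Fin d → ℝ)
    (Q : Measure (Fin T → Ω₁)) : Prop :=
  (∀ (t : ℕ) (h : t ≤ T) (i : Fin d), Integrable (fun ω => S t (restr Ω₁ t h ω) i) Q) ∧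
  (∀ (t : ℕ) (h : t + 1 ≤ T) (i : Fin d) (A : Set (Fin T → Ω₁)),
    MeasurableSet[filtr Ω₁ T t ((Nat.le_succ t).trans h)] A →
      ∫ ω in A, S (t + 1) (restr Ω₁ (t + 1) h ω) i ∂Q
        = ∫ ω in A, S t (restr Ω₁ t ((Nat.le_succ t).trans h) ω) i ∂Q)

/-- The martingale measures `Q ⋘ PP` consistent with the option prices:
`𝒬 = {Q ⋘ PP : S is a Q-martingale, E_Q[gⁱ] = 0}`. -/
def QSet {T d e : ℕ} (PP : Set (Measure (Fin T → Ω₁)))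
    (S : (t : ℕ) → (Fin t → Ω₁) → Fin d → ℝ) (g : Fin e → (Fin T → Ω₁) → ℝ) :
    Set (Measure (Fin T → Ω₁)) :=
  {Q | IsProbabilityMeasure Q ∧ (∃ P ∈ PP, Q ≪ P) ∧ IsMartMeas Ω₁ S Q ∧
    ∀ i : Fin e, expec Q (g i) = 0}

/-- The no-arbitrage condition `NA(PP)` with semistatic trading in the stocks `S`
and the options `g`. -/
def NA {T d e : ℕ} (PP : Set (Measure (Fin T → Ω₁)))
    (S : (t : ℕ) → (Fin t → Ω₁) → Fin d → ℝ) (g : Fin e → (Fin T → Ω₁) → ℝ) : Prop :=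
  ∀ H : (u : ℕ) → (Fin u → Ω₁) → Fin d → ℝ, Pred Ω₁ d H → ∀ h : Fin e → ℝ,
    QuasiSure PP (univComp (Fin T → Ω₁))
      (fun ω => 0 ≤ gain Ω₁ S H T le_rfl ω + ∑ i, h i * g i ω) →
    QuasiSure PP (univComp (Fin T → Ω₁))
      (fun ω => gain Ω₁ S H T le_rfl ω + ∑ i, h i * g i ω = 0)

/-- The minimal semistatic superhedging price, valued in `EReal` (`inf ∅ = +∞`). -/
def superPrice {T d e : ℕ} (PP : Set (Measure (Fin T → Ω₁)))
    (S : (t : ℕ) → (Fin t → Ω₁) → Fin d → ℝ) (g : Fin e → (Fin T → Ω₁) → ℝ)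
    (f : (Fin T → Ω₁) → ℝ) : EReal :=
  sInf ((fun x : ℝ => (x : EReal)) ''
    {x : ℝ | ∃ H : (u : ℕ) → (Fin u → Ω₁) → Fin d → ℝ, ∃ h : Fin e → ℝ, Pred Ω₁ d H ∧
      QuasiSure PP (univComp (Fin T → Ω₁))
        (fun ω => f ω ≤ x + gain Ω₁ S H T le_rfl ω + ∑ i, h i * g i ω)})

/-- `f` is replicable by semistatic trading. -/
def Replicable {T d e : ℕ} (PP : Set (Measure (Fin T → Ω₁)))
    (S : (t : ℕ) → (Fin t → Ω₁) → Fin d → ℝ) (g : Fin e → (Fin T → Ω₁) → ℝ)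
    (f : (Fin T → Ω₁) → ℝ) : Prop :=
  ∃ x : ℝ, ∃ H : (u : ℕ) → (Fin u → Ω₁) → Fin d → ℝ, ∃ h : Fin e → ℝ, Pred Ω₁ d H ∧
    QuasiSure PP (univComp (Fin T → Ω₁))
      (fun ω => x + gain Ω₁ S H T le_rfl ω + ∑ i, h i * g i ω = f ω)

/-- The one-period increment `ΔS_{t+1}(ω, ·)` of the stock, given history `ω ∈ Ω_t`. -/
def incr {d : ℕ} (S : (t : ℕ) → (Fin t → Ω₁) → Fin d → ℝ) (t : ℕ) (ω : Fin t → Ω₁)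
    (x : Ω₁) : Fin d → ℝ :=
  fun i => S (t + 1) (Fin.snoc ω x) i - S t ω i

/-- The one-step martingale measures `𝒬_t(ω)` dominated by `𝒫_t(ω)`. -/
def Q1fam {d : ℕ} (Pt : (t : ℕ) → (Fin t → Ω₁) → Set (ProbabilityMeasure Ω₁))
    (S : (t : ℕ) → (Fin t → Ω₁) → Fin d → ℝ) (t : ℕ) (ω : Fin t → Ω₁) :
    Set (ProbabilityMeasure Ω₁) :=
  {Q | (∃ P' ∈ Pt t ω, (Q : Measure Ω₁) ≪ (P' : Measure Ω₁)) ∧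
    ∀ i, expec (Q : Measure Ω₁) (fun x => incr Ω₁ S t ω x i) = 0}

/-- `V` is a `Q`-supermartingale with respect to the filtration `(ℱ_t)`:
each `V_t` is `Q`-integrable and `E_Q[V_{t+1} | ℱ_t] ≤ V_t`. -/
def IsSupermart {T : ℕ} (V : ℕ → (Fin T → Ω₁) → ℝ) (Q : Measure (Fin T → Ω₁)) : Prop :=
  (∀ t : ℕ, t ≤ T → Integrable (V t) Q) ∧
  ∀ (t : ℕ) (h : t + 1 ≤ T) (A : Set (Fin T → Ω₁)),
    MeasurableSet[filtr Ω₁ T t ((Nat.le_succ t).trans h)] A →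
      ∫ ω in A, V (t + 1) ω ∂Q ≤ ∫ ω in A, V t ω ∂Q

end Polish

/-! ### Quasi-sure supports -/

/-- The quasi-sure support of a family of measures on `ℝ^d`. -/
def qsSupp {d : ℕ} (Rs : Set (Measure (Fin d → ℝ))) : Set (Fin d → ℝ) :=
  ⋂₀ {A : Set (Fin d → ℝ) | IsClosed A ∧ ∀ R ∈ Rs, R A = 1}

end BN

set_option linter.unusedSectionVars false

namespace BN

open ProbabilityTheory
open scoped Matrix

/-! ### Universal measurability of analytic sets -/

theorem exists_bounds_of_lt_measure_range {X : Type*} [MeasurableSpace X] (μ : Measure X)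
    (f : (ℕ → ℕ) → X) {c : ℝ≥0∞} (hc : c < μ (range f)) :
    ∃ n : ℕ → ℕ, ∀ k, c < μ (f '' {z | ∀ i < k, z i ≤ n i}) := by
  have step : ∀ (k : ℕ) (B : {B : Set (ℕ → ℕ) // c < μ (f '' B)}),
      ∃ m : ℕ, c < μ (f '' (B.1 ∩ {z | z k ≤ m})) := by
    intro k B
    have hU : f '' B.1 = ⋃ m : ℕ, f '' (B.1 ∩ {z | z k ≤ m}) := by
      rw [← image_iUnion, ← inter_iUnion]
      congr 1
      ext z
      simp only [mem_inter_iff, mem_iUnion, mem_ofPred_eq]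
      exact ⟨fun h => ⟨h, _, le_rfl⟩, fun h => h.1⟩
    have hmono : Monotone fun m : ℕ => f '' (B.1 ∩ {z | z k ≤ m}) := fun a b hab =>
      image_mono (inter_subset_inter_right _ fun z (hz : z k ≤ a) => hz.trans hab)
    have := B.2
    rw [hU, hmono.measure_iUnion] at this
    exact lt_iSup_iff.1 this
  choose N hN using step
  let s : ℕ → {B : Set (ℕ → ℕ) // c < μ (f '' B)} := fun k =>
    Nat.rec ⟨univ, by rwa [image_univ]⟩ (fun k B => ⟨_, hN k B⟩) k
  have hs : ∀ k, (s k).1 = {z | ∀ i < k, z i ≤ N i (s i)} := by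
    intro k
    induction k with
    | zero => ext z; simp [s]
    | succ k ih =>
      change (s k).1 ∩ {z | z k ≤ N k (s k)} = _
      rw [ih]
      ext z
      simp only [mem_inter_iff, mem_ofPred_eq, Nat.lt_succ_iff_lt_or_eq]
      grind
  exact ⟨fun k => N k (s k), fun k => by rw [← hs k]; exact (s k).2⟩

theorem isCompact_setOf_forall_le (n : ℕ → ℕ) : IsCompact {z : ℕ → ℕ | ∀ i, z i ≤ n i} := by
  have : {z : ℕ → ℕ | ∀ i, z i ≤ n i} = Set.pi univ fun i => Iic (n i) := by
    ext z; simp [Pi.le_def]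
  rw [this]
  exact isCompact_univ_pi fun i => (finite_Iic _).isCompact

theorem iInter_closure_image_subset {X : Type*} [TopologicalSpace X] [T2Space X]
    {f : (ℕ → ℕ) → X} (hf : Continuous f) (n : ℕ → ℕ) :
    ⋂ k, closure (f '' {z | ∀ i < k, z i ≤ n i}) ⊆ f '' {z | ∀ i, z i ≤ n i} := by
  let _ : MetricSpace (ℕ → ℕ) := PiNat.metricSpaceNatNat
  intro x hx
  by_contra hxK
  have hK := isCompact_setOf_forall_le n
  obtain ⟨U, V, hU, hV, hKU, hxV, hUV⟩ := SeparatedNhds.of_isCompact_isCompact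
    (hK.image hf) (isCompact_singleton (x := x)) (by simpa using hxK)
  have hKU' : {z : ℕ → ℕ | ∀ i, z i ≤ n i} ⊆ f ⁻¹' U := image_subset_iff.1 hKU
  obtain ⟨δ, hδ, hth⟩ := hK.exists_thickening_subset_open (hU.preimage hf) hKU'
  obtain ⟨k, hk⟩ := exists_pow_lt_of_lt_one hδ (by norm_num : (1 / 2 : ℝ) < 1)
  have hB : f '' {z | ∀ i < k, z i ≤ n i} ⊆ U := by
    rintro _ ⟨z, hz, rfl⟩
    apply hth
    rw [Metric.mem_thickening_iff]
    refine ⟨fun i => min (z i) (n i), fun i => min_le_right _ _, lt_of_le_of_lt ?_ hk⟩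
    refine PiNat.mem_cylinder_iff_dist_le.1 ?_
    rw [PiNat.mem_cylinder_iff]
    intro i hi
    exact (min_eq_left (hz i hi)).symm
  obtain ⟨y, hyV, hyB⟩ := mem_closure_iff.1 (mem_iInter.1 hx k) V hV (hxV rfl)
  exact disjoint_left.1 hUV (hB hyB) hyV

theorem nullMeasurableSet_of_analyticSet {X : Type*} [TopologicalSpace X] [T2Space X]
    [MeasurableSpace X] [OpensMeasurableSpace X] (μ : Measure X) [IsFiniteMeasure μ] {s : Set X}
    (hs : AnalyticSet s) : NullMeasurableSet s μ := by
  rw [AnalyticSet] at hs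
  rcases hs with rfl | ⟨f, hf, rfl⟩
  · exact nullMeasurableSet_empty
  have key : ∀ c < μ (range f), ∃ M ⊆ range f, MeasurableSet M ∧ c ≤ μ M := by
    intro c hc
    obtain ⟨n, hn⟩ := exists_bounds_of_lt_measure_range μ f hc
    refine ⟨f '' {z | ∀ i, z i ≤ n i}, image_subset_range _ _,
      ((isCompact_setOf_forall_le n).image hf).isClosed.measurableSet, ?_⟩
    have hanti : Antitone fun k => closure (f '' {z | ∀ i < k, z i ≤ n i}) := fun a b hab =>
      closure_mono (image_mono fun z hz i hi => hz i (hi.trans_le hab))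
    refine le_trans ?_ (measure_mono (iInter_closure_image_subset hf n))
    rw [hanti.measure_iInter (fun k => isClosed_closure.measurableSet.nullMeasurableSet)
      ⟨0, measure_ne_top _ _⟩]
    exact le_iInf fun k => (hn k).le.trans (measure_mono subset_closure)
  by_cases h0 : μ (range f) = 0
  · exact NullMeasurableSet.of_null h0
  obtain ⟨u, -, hu, hlim⟩ := exists_seq_strictMono_tendsto' (pos_iff_ne_zero.2 h0)
  choose M hMs hMm hMc using fun k => key (u k) (hu k).2
  have hle : μ (range f) ≤ μ (⋃ k, M k) :=
    le_of_tendsto' hlim fun k => (hMc k).trans (measure_mono (subset_iUnion _ _))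
  have hMU : MeasurableSet (⋃ k, M k) := MeasurableSet.iUnion hMm
  have := ae_eq_of_subset_of_measure_ge (iUnion_subset hMs) hle hMU.nullMeasurableSet
    (measure_ne_top _ _)
  exact hMU.nullMeasurableSet.congr this

theorem univComp_of_analyticSet {X : Type*} [TopologicalSpace X] [T2Space X]
    [MeasurableSpace X] [OpensMeasurableSpace X] {s : Set X} (hs : AnalyticSet s) :
    MeasurableSet[univComp X] s := fun μ _ => nullMeasurableSet_of_analyticSet μ hs

theorem le_univComp {X : Type*} [m : MeasurableSpace X] : m ≤ univComp X :=
  fun _ hs _ _ => hs.nullMeasurableSet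

theorem nullMeasurable_of_univComp {X Y : Type*} [MeasurableSpace X] [MeasurableSpace Y]
    {f : X → Y} (hf : Measurable[univComp X] f) (μ : Measure X) [IsProbabilityMeasure μ] :
    NullMeasurable f μ := fun _ hs => hf hs μ inferInstance

theorem aemeasurable_of_univComp {X Y : Type*} [MeasurableSpace X] [MeasurableSpace Y]
    [MeasurableSpace.CountablyGenerated Y] {f : X → Y} (hf : Measurable[univComp X] f)
    (μ : Measure X) [IsProbabilityMeasure μ] : AEMeasurable f μ :=
  (nullMeasurable_of_univComp hf μ).aemeasurable

theorem measurable_univComp_univComp {X Y : Type*} [MeasurableSpace X] [MeasurableSpace Y]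
    [MeasurableSpace.CountablyGenerated Y] {f : X → Y} (hf : Measurable[univComp X] f) :
    Measurable[univComp X, univComp Y] f := by
  intro s hs μ hμ
  have hfa := aemeasurable_of_univComp hf μ
  have := hs (μ.map f) (Measure.isProbabilityMeasure_map hfa)
  obtain ⟨t, ht, hst⟩ := this
  have h1 : f ⁻¹' t =ᵐ[μ] f ⁻¹' s := by
    have := ae_of_ae_map hfa hst
    filter_upwards [this] with x hx using hx.symm
  exact (hf ht μ hμ).congr h1

/-! ### Measurable selection -/

section Selection

variable {X : Type*} (φ : (ℕ → ℕ) → X)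

/-- The image under `φ` of the sequences that start with the (reversed) list `l`. -/
def branchImage (l : List ℕ) : Set X := φ '' {z | PiNat.res z l.length = l}

/-- The smallest admissible continuation of the (reversed) list `l` in the fibre over `x`. -/
def leastStep (l : List ℕ) (x : X) : ℕ := sInf {m | x ∈ branchImage φ (m :: l)}

/-- The initial segment of length `k` of the leftmost branch over `x`, in reversed order. -/
def leftmostSeg : ℕ → X → List ℕ
  | 0, _ => []
  | k + 1, x => leastStep φ (leftmostSeg k x) x :: leftmostSeg k x

/-- The leftmost branch in the fibre of `φ` over `x`. -/
def leftmostBranch (x : X) (k : ℕ) : ℕ := leastStep φ (leftmostSeg φ k x) x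

theorem res_leftmostBranch (x : X) (k : ℕ) :
    PiNat.res (leftmostBranch φ x) k = leftmostSeg φ k x := by
  induction k with
  | zero => rfl
  | succ k ih => rw [PiNat.res_succ, ih]; rfl

theorem leftmostSeg_length (x : X) (k : ℕ) : (leftmostSeg φ k x).length = k := by
  rw [← res_leftmostBranch, PiNat.res_length]

theorem mem_branchImage_leftmostSeg {x : X} (hx : x ∈ range φ) (k : ℕ) :
    x ∈ branchImage φ (leftmostSeg φ k x) := by
  induction k with
  | zero =>
    obtain ⟨z, rfl⟩ := hx
    exact ⟨z, rfl, rfl⟩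
  | succ k ih =>
    obtain ⟨z, hz, hzx⟩ := ih
    have hne : {m | x ∈ branchImage φ (m :: leftmostSeg φ k x)}.Nonempty := by
      refine ⟨z (leftmostSeg φ k x).length, z, ?_, hzx⟩
      change PiNat.res z (leftmostSeg φ k x).length = _ at hz
      change PiNat.res z ((leftmostSeg φ k x).length + 1) = _
      rw [PiNat.res_succ, hz]
    exact Nat.sInf_mem hne

theorem apply_leftmostBranch [TopologicalSpace X] [T2Space X] (hφ : Continuous φ) {x : X}
    (hx : x ∈ range φ) : φ (leftmostBranch φ x) = x := by
  choose z hz hzx using fun k => mem_branchImage_leftmostSeg φ hx k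
  have hlim : Tendsto z atTop (𝓝 (leftmostBranch φ x)) := by
    rw [tendsto_pi_nhds]
    intro i
    refine tendsto_const_nhds.congr' ?_
    filter_upwards [eventually_gt_atTop i] with k hk
    have h := hz k
    change PiNat.res (z k) (leftmostSeg φ k x).length = _ at h
    rw [leftmostSeg_length, ← res_leftmostBranch] at h
    exact (PiNat.res_eq_res.1 h hk).symm
  have h1 := (hφ.tendsto _).comp hlim
  have h2 : φ ∘ z = fun _ => x := funext hzx
  rw [h2] at h1
  exact tendsto_nhds_unique h1 tendsto_const_nhds

theorem analyticSet_branchImage [TopologicalSpace X] (hφ : Continuous φ) (l : List ℕ) :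
    AnalyticSet (branchImage φ l) := by
  refine IsOpen.analyticSet_image ?_ hφ
  rw [isOpen_iff_mem_nhds]
  intro z hz
  refine mem_of_superset ((PiNat.isOpen_cylinder _ z l.length).mem_nhds
    (PiNat.self_mem_cylinder z _)) fun w hw => ?_
  rw [PiNat.cylinder_eq_res] at hw
  exact Eq.trans hw hz

theorem measurable_leftmostBranch [TopologicalSpace X] [T2Space X] [MeasurableSpace X]
    [OpensMeasurableSpace X] (hφ : Continuous φ) :
    Measurable[univComp X] (leftmostBranch φ) := by
  let _ : MeasurableSpace (List ℕ) := ⊤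
  have hstep : ∀ l, Measurable[univComp X] (leastStep φ l) := by
    intro l
    refine @measurable_to_nat X (univComp X) _ fun x => ?_
    have hset : ∀ m, MeasurableSet[univComp X] {y | y ∈ branchImage φ (m :: l)} := fun m =>
      univComp_of_analyticSet (analyticSet_branchImage φ hφ _)
    have hM : ∀ m, MeasurableSet[univComp X] {y | leastStep φ l y < m + 1} := by
      intro m
      have : {y | leastStep φ l y < m + 1} = (⋃ j ∈ Iic m, {y | y ∈ branchImage φ (j :: l)}) ∪
          ⋂ j, {y | y ∈ branchImage φ (j :: l)}ᶜ := by
        ext y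
        simp only [mem_ofPred_eq, mem_union, mem_iUnion, mem_iInter, mem_compl_iff, mem_Iic]
        constructor
        · intro h
          by_cases hne : ∃ j, y ∈ branchImage φ (j :: l)
          · exact Or.inl ⟨_, Nat.lt_succ_iff.1 h,
              Nat.sInf_mem (s := {m | y ∈ branchImage φ (m :: l)}) hne⟩
          · exact Or.inr (not_exists.1 hne)
        · rintro (⟨j, hj, hy⟩ | h)
          · exact Nat.lt_succ_of_le ((Nat.sInf_le (s := {m | y ∈ branchImage φ (m :: l)}) hy).trans hj)
          · have : {m | y ∈ branchImage φ (m :: l)} = ∅ := by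
              ext m; simpa using h m
            simp [leastStep, this]
      rw [this]
      exact (MeasurableSet.biUnion (to_countable _) fun j _ => hset j).union
        (MeasurableSet.iInter fun j => (hset j).compl)
    have hlt : ∀ m, MeasurableSet[univComp X] {y | leastStep φ l y < m} := by
      intro m
      cases m with
      | zero => simp
      | succ m => exact hM m
    have : leastStep φ l ⁻¹' {leastStep φ l x} =
        {y | leastStep φ l y < leastStep φ l x + 1} \ {y | leastStep φ l y < leastStep φ l x} := by
      ext y
      simp only [mem_preimage, mem_singleton_iff, Set.mem_sdiff, mem_ofPred_eq]
      omega
    rw [this]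
    exact (hM _).diff (hlt _)
  have hcomp : ∀ g : X → List ℕ, Measurable[univComp X] g →
      Measurable[univComp X] fun x => leastStep φ (g x) x := by
    intro g hg s hs
    have : (fun x => leastStep φ (g x) x) ⁻¹' s = ⋃ l, g ⁻¹' {l} ∩ leastStep φ l ⁻¹' s := by
      ext x; simp
    rw [this]
    exact MeasurableSet.iUnion fun l => (hg (MeasurableSpace.measurableSet_top)).inter
      (hstep l hs)
  have hpre : ∀ k, Measurable[univComp X] (leftmostSeg φ k) := by
    intro k
    induction k with
    | zero => exact @measurable_const _ _ _ (univComp X) _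
    | succ k ih =>
      intro s _
      have : leftmostSeg φ (k + 1) ⁻¹' s = ⋃ l, ⋃ m, ⋃ _ : (m :: l) ∈ s,
          leftmostSeg φ k ⁻¹' {l} ∩ (fun x => leastStep φ (leftmostSeg φ k x) x) ⁻¹' {m} := by
        ext x
        simp only [mem_preimage, leftmostSeg, mem_iUnion, mem_inter_iff, mem_singleton_iff]
        constructor
        · intro h; exact ⟨_, _, h, rfl, rfl⟩
        · rintro ⟨l, m, h, rfl, rfl⟩; exact h
      rw [this]
      refine MeasurableSet.iUnion fun l => MeasurableSet.iUnion fun m =>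
        MeasurableSet.iUnion fun _ => ?_
      exact (ih MeasurableSpace.measurableSet_top).inter (hcomp _ ih (measurableSet_singleton m))
  exact @measurable_pi_lambda _ _ _ (univComp X) _ _ fun k => hcomp _ (hpre k)

end Selection

/-- Jankov–von Neumann selection for a Borel map on a Borel subset of a Polish space. -/
theorem exists_univComp_selector {X Y : Type*} [TopologicalSpace X] [PolishSpace X]
    [MeasurableSpace X] [BorelSpace X] [TopologicalSpace Y] [PolishSpace Y] [MeasurableSpace Y]
    [BorelSpace Y] [Nonempty Y] {g : Y → X} (hg : Measurable g) {E : Set Y}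
    (hE : MeasurableSet E) :
    MeasurableSet[univComp X] (g '' E) ∧ ∃ σ : X → Y, Measurable[univComp X] σ ∧
      ∀ x ∈ g '' E, σ x ∈ E ∧ g (σ x) = x := by
  have hGm : MeasurableSet {p : X × Y | p.2 ∈ E ∧ g p.2 = p.1} :=
    (measurable_snd hE).inter (measurableSet_eq_fun (hg.comp measurable_snd) measurable_fst)
  have hGa := hGm.analyticSet
  have hproj : Prod.fst '' {p : X × Y | p.2 ∈ E ∧ g p.2 = p.1} = g '' E := by
    ext x
    constructor
    · rintro ⟨⟨x, y⟩, ⟨hy, hyx⟩, rfl⟩; exact ⟨y, hy, hyx⟩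
    · rintro ⟨y, hy, rfl⟩; exact ⟨(g y, y), ⟨hy, rfl⟩, rfl⟩
  refine ⟨?_, ?_⟩
  · rw [← hproj]
    exact univComp_of_analyticSet (hGa.image_of_continuous continuous_fst)
  · rw [AnalyticSet] at hGa
    rcases hGa with h0 | ⟨h, hc, hr⟩
    · rw [h0, image_empty] at hproj
      refine ⟨fun _ => Classical.arbitrary Y, @measurable_const _ _ _ (univComp X) _, ?_⟩
      rw [← hproj]
      simp
    · have hφ : Continuous fun z => (h z).1 := continuous_fst.comp hc
      refine ⟨fun x => (h (leftmostBranch (fun z => (h z).1) x)).2,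
        (continuous_snd.comp hc).measurable.comp (measurable_leftmostBranch _ hφ), ?_⟩
      intro x hx
      rw [← hproj, ← hr, ← range_comp] at hx
      have h1 := apply_leftmostBranch _ hφ hx
      have h2 : h (leftmostBranch (fun z => (h z).1) x) ∈
          {p : X × Y | p.2 ∈ E ∧ g p.2 = p.1} := hr ▸ mem_range_self _
      exact ⟨h2.1, h2.2.trans h1⟩

/-! ### Kernels and product measures -/

section Kernels

variable {E : Type*} [MeasurableSpace E] [TopologicalSpace E] [PolishSpace E] [BorelSpace E]

theorem measurable_toMeasure_borel :
    Measurable[borel (ProbabilityMeasure E)] fun P : ProbabilityMeasure E => (P : Measure E) := by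
  let _ : MeasurableSpace (ProbabilityMeasure E) := borel _
  have _ : BorelSpace (ProbabilityMeasure E) := ⟨rfl⟩
  let _ := TopologicalSpace.upgradeIsCompletelyMetrizable E
  refine Measurable.measure_of_isPiSystem_of_isProbabilityMeasure
    (BorelSpace.measurable_eq.trans borel_eq_generateFrom_isClosed) isPiSystem_isClosed ?_
  intro F hF
  have hF' : IsClosed F := hF
  refine measurable_of_tendsto_metrizable (f := fun n (P : ProbabilityMeasure E) =>
    ∫⁻ x, (hF'.apprSeq n x : ℝ≥0∞) ∂(P : Measure E)) (fun n => ?_) ?_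
  · exact (ProbabilityMeasure.continuous_lintegral_boundedContinuousFunction _).measurable
  · rw [tendsto_pi_nhds]
    intro P
    exact HasOuterApproxClosed.tendsto_lintegral_apprSeq hF' (P : Measure E)

variable {X : Type*} [MeasurableSpace X]

/-- A universally measurable map into the space of probability measures agrees almost everywhere
with a Markov kernel. -/
theorem exists_kernel_ae_eq (ν : Measure X) [IsProbabilityMeasure ν]
    {κ : X → ProbabilityMeasure E} (hκ : Measurable[univComp X, borel (ProbabilityMeasure E)] κ) :
    ∃ η : Kernel X E, IsMarkovKernel η ∧ ∀ᵐ ω ∂ν, η ω = (κ ω : Measure E) := by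
  have hκ' : Measurable[univComp X] fun ω => (κ ω : Measure E) :=
    measurable_toMeasure_borel.comp hκ
  let 𝒜 := generateSetAlgebra (MeasurableSpace.countableGeneratingSet E)
  have h𝒜c : 𝒜.Countable :=
    countable_generateSetAlgebra (MeasurableSpace.countable_countableGeneratingSet (α := E))
  have h𝒜g : ‹MeasurableSpace E› = MeasurableSpace.generateFrom 𝒜 := by
    rw [generateFrom_generateSetAlgebra_eq, MeasurableSpace.generateFrom_countableGeneratingSet]
  have h𝒜m : ∀ s ∈ 𝒜, MeasurableSet s := fun s hs => by
    rw [h𝒜g]; exact MeasurableSpace.measurableSet_generateFrom hs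
  have _ : Countable 𝒜 := h𝒜c.to_subtype
  have hae : AEMeasurable (fun ω (s : 𝒜) => (κ ω : Measure E) s) ν := by
    refine aemeasurable_pi_lambda _ fun s => ?_
    exact aemeasurable_of_univComp ((Measure.measurable_coe (h𝒜m s s.2)).comp hκ') ν
  obtain ⟨g, hg, hgκ⟩ := hae
  obtain ⟨B, hB, hBm, hBν⟩ : ∃ B ⊆ {ω | (fun s : 𝒜 => (κ ω : Measure E) s) = g ω},
      MeasurableSet B ∧ B ∈ ae ν := by
    refine ⟨(toMeasurable ν {ω | (fun s : 𝒜 => (κ ω : Measure E) s) = g ω}ᶜ)ᶜ,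
      compl_subset_comm.1 (subset_toMeasurable _ _), (measurableSet_toMeasurable _ _).compl, ?_⟩
    rw [mem_ae_iff, compl_compl, measure_toMeasurable]
    exact hgκ
  by_cases hX : Nonempty X
  · let x₀ := Classical.choice hX
    classical
    let κ' : X → Measure E := fun ω => if ω ∈ B then κ ω else κ x₀
    have hprob : ∀ ω, IsProbabilityMeasure (κ' ω) := fun ω => by
      simp only [κ']; split_ifs <;> infer_instance
    have hκ'm : Measurable κ' := by
      refine Measurable.measure_of_isPiSystem_of_isProbabilityMeasure h𝒜g
        isSetAlgebra_generateSetAlgebra.isSetRing.isSetSemiring.isPiSystem fun s hs => ?_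
      have : (fun ω => κ' ω s) = fun ω => if ω ∈ B then g ω ⟨s, hs⟩ else (κ x₀ : Measure E) s := by
        funext ω
        by_cases hω : ω ∈ B
        · have h1 : (fun s : 𝒜 => (κ ω : Measure E) s) = g ω := hB hω
          simp only [κ', hω, if_true, ← h1]
        · simp only [κ', hω, if_false]
      rw [this]
      exact Measurable.ite hBm ((measurable_pi_apply _).comp hg) measurable_const
    refine ⟨⟨κ', hκ'm⟩, ⟨hprob⟩, ?_⟩
    filter_upwards [hBν] with ω hω
    simp only [Kernel.coe_mk, κ', hω, if_true]
  · exact absurd (Measure.nonempty_of_neZero ν) hX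

end Kernels

section Paths

variable {Ω₁ : Type} [MeasurableSpace Ω₁]

/-- The path extended by one coordinate. -/
def snocPath {t : ℕ} (p : (Fin t → Ω₁) × Ω₁) : Fin (t + 1) → Ω₁ := Fin.snoc p.1 p.2

theorem measurable_snocPath {t : ℕ} : Measurable (snocPath : (Fin t → Ω₁) × Ω₁ → _) := by
  rw [measurable_pi_iff]
  intro i
  refine Fin.lastCases ?_ (fun j => ?_) i
  · simpa [snocPath] using measurable_snd
  · simp only [snocPath, Fin.snoc_castSucc]
    exact (measurable_pi_apply j).comp measurable_fst

theorem measurable_restr {T : ℕ} (t : ℕ) (h : t ≤ T) : Measurable (restr Ω₁ (T := T) t h) :=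
  measurable_pi_lambda _ fun _ => measurable_pi_apply _

theorem restr_snocPath {t : ℕ} (p : (Fin t → Ω₁) × Ω₁) :
    restr Ω₁ t t.le_succ (snocPath p) = p.1 := by
  funext i
  change Fin.snoc (α := fun _ => Ω₁) p.1 p.2 (Fin.castSucc i) = _
  simp

theorem snocPath_restr {t : ℕ} (ω : Fin (t + 1) → Ω₁) :
    snocPath (restr Ω₁ t t.le_succ ω, ω (Fin.last t)) = ω := by
  funext i
  refine Fin.lastCases ?_ (fun j => ?_) i
  · simp [snocPath]
  · simp only [snocPath, restr, Fin.snoc_castSucc]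
    rfl

variable [TopologicalSpace Ω₁] [PolishSpace Ω₁] [BorelSpace Ω₁]

theorem bind_map_snoc_eq {t : ℕ} (ν : Measure (Fin t → Ω₁)) [IsProbabilityMeasure ν]
    {κ : (Fin t → Ω₁) → ProbabilityMeasure Ω₁} {η : Kernel (Fin t → Ω₁) Ω₁} [IsMarkovKernel η]
    (h : ∀ᵐ ω ∂ν, η ω = (κ ω : Measure Ω₁)) :
    ν.bind (fun ω => Measure.map (Fin.snoc ω) (κ ω : Measure Ω₁)) =
      (ν ⊗ₘ η).map (snocPath (t := t)) := by
  have hms : ∀ ω : Fin t → Ω₁, Measurable (fun x => snocPath (ω, x)) := fun ω =>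
    measurable_snocPath.comp (measurable_const.prodMk measurable_id)
  have h1 : (fun ω => Measure.map (Fin.snoc ω) (κ ω : Measure Ω₁)) =ᵐ[ν]
      fun ω => ((η ω).map fun x => snocPath (ω, x) : Measure (Fin (t + 1) → Ω₁)) := by
    filter_upwards [h] with ω hω
    rw [hω]
    rfl
  have heq : ∀ s : Set (Fin (t + 1) → Ω₁), MeasurableSet s → ∀ ω,
      ((η ω).map fun x => snocPath (ω, x)) s = η ω (Prod.mk ω ⁻¹' (snocPath ⁻¹' s)) := by
    intro s hs ω
    rw [Measure.map_apply (hms ω) hs]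
    rfl
  have hm : Measurable fun ω => ((η ω).map fun x => snocPath (ω, x) :
      Measure (Fin (t + 1) → Ω₁)) := by
    refine Measure.measurable_of_measurable_coe _ fun s hs => ?_
    simp_rw [heq s hs]
    exact Kernel.measurable_kernel_prodMk_left (measurable_snocPath hs)
  rw [Measure.bind_congr_right h1]
  ext s hs
  rw [Measure.bind_apply hs hm.aemeasurable, Measure.map_apply measurable_snocPath hs,
    Measure.compProd_apply (measurable_snocPath hs)]
  simp_rw [heq s hs]

theorem isProbabilityMeasure_of_mem_measFam
    {Pt : (t : ℕ) → (Fin t → Ω₁) → Set (ProbabilityMeasure Ω₁)} {t : ℕ}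
    {P : Measure (Fin t → Ω₁)} (hP : P ∈ MeasFam Ω₁ Pt t) : IsProbabilityMeasure P := by
  induction t with
  | zero =>
    have : P = Measure.dirac Fin.elim0 := hP
    rw [this]; infer_instance
  | succ t ih =>
    obtain ⟨ν, hν, κ, hκ, -, rfl⟩ := hP
    have := ih hν
    obtain ⟨η, _, hη⟩ := exists_kernel_ae_eq ν hκ
    rw [bind_map_snoc_eq ν hη]
    exact Measure.isProbabilityMeasure_map measurable_snocPath.aemeasurable

/-- Elements of the family at time `t + 1`, written with Markov kernels. -/
theorem exists_kernel_of_mem_measFam_succ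
    {Pt : (t : ℕ) → (Fin t → Ω₁) → Set (ProbabilityMeasure Ω₁)} {t : ℕ}
    {P : Measure (Fin (t + 1) → Ω₁)} (hP : P ∈ MeasFam Ω₁ Pt (t + 1)) :
    ∃ ν ∈ MeasFam Ω₁ Pt t, ∃ κ : (Fin t → Ω₁) → ProbabilityMeasure Ω₁,
      Measurable[univComp (Fin t → Ω₁), borel (ProbabilityMeasure Ω₁)] κ ∧
      (∀ ω, κ ω ∈ Pt t ω) ∧
      ∀ η : Kernel (Fin t → Ω₁) Ω₁, IsMarkovKernel η → (∀ᵐ ω ∂ν, η ω = (κ ω : Measure Ω₁)) →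
        P = (ν ⊗ₘ η).map (snocPath (t := t)) := by
  obtain ⟨ν, hν, κ, hκ, hκP, rfl⟩ := hP
  have := isProbabilityMeasure_of_mem_measFam hν
  exact ⟨ν, hν, κ, hκ, hκP, fun η _ h => bind_map_snoc_eq ν h⟩

/-- A measure in the family extended by one universally measurable selector. -/
theorem exists_measFam_succ
    {Pt : (t : ℕ) → (Fin t → Ω₁) → Set (ProbabilityMeasure Ω₁)} {t : ℕ}
    {ν : Measure (Fin t → Ω₁)} (hν : ν ∈ MeasFam Ω₁ Pt t)
    {κ : (Fin t → Ω₁) → ProbabilityMeasure Ω₁}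
    (hκ : Measurable[univComp (Fin t → Ω₁), borel (ProbabilityMeasure Ω₁)] κ)
    (hκP : ∀ ω, κ ω ∈ Pt t ω) :
    ∃ η : Kernel (Fin t → Ω₁) Ω₁, IsMarkovKernel η ∧ (∀ᵐ ω ∂ν, η ω = (κ ω : Measure Ω₁)) ∧
      (ν ⊗ₘ η).map (snocPath (t := t)) ∈ MeasFam Ω₁ Pt (t + 1) := by
  have := isProbabilityMeasure_of_mem_measFam hν
  obtain ⟨η, hη, h⟩ := exists_kernel_ae_eq ν hκ
  exact ⟨η, hη, h, ν, hν, κ, hκ, hκP, (bind_map_snoc_eq ν h).symm⟩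

theorem map_restr_compProd {t : ℕ} (ν : Measure (Fin t → Ω₁)) [SFinite ν]
    (η : Kernel (Fin t → Ω₁) Ω₁) [IsMarkovKernel η] :
    ((ν ⊗ₘ η).map (snocPath (t := t))).map (restr Ω₁ t t.le_succ) = ν := by
  rw [Measure.map_map (measurable_restr _ _) measurable_snocPath]
  have : restr Ω₁ t t.le_succ ∘ snocPath = Prod.fst := funext restr_snocPath
  rw [this]
  exact Measure.fst_compProd ν η

/-- Every measure up to time `t` is the marginal of a measure up to time `T`. -/
theorem exists_extension {Pt : (t : ℕ) → (Fin t → Ω₁) → Set (ProbabilityMeasure Ω₁)} {T : ℕ}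
    (hsel : ∀ t < T, ∃ κ : (Fin t → Ω₁) → ProbabilityMeasure Ω₁,
      Measurable[univComp (Fin t → Ω₁), borel (ProbabilityMeasure Ω₁)] κ ∧ ∀ ω, κ ω ∈ Pt t ω)
    {t : ℕ} (ht : t ≤ T) {ν : Measure (Fin t → Ω₁)} (hν : ν ∈ MeasFam Ω₁ Pt t) :
    ∃ P ∈ MeasFam Ω₁ Pt T, P.map (restr Ω₁ t ht) = ν := by
  induction T, ht using Nat.le_induction with
  | base => exact ⟨ν, hν, Measure.map_id⟩
  | succ T hT ih =>
    obtain ⟨P, hP, hPν⟩ := ih fun s hs => hsel s (hs.trans T.lt_succ_self)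
    have := isProbabilityMeasure_of_mem_measFam hP
    obtain ⟨κ, hκ, hκP⟩ := hsel T T.lt_succ_self
    obtain ⟨η, _, -, hmem⟩ := exists_measFam_succ hP hκ hκP
    refine ⟨_, hmem, ?_⟩
    have : restr Ω₁ t (hT.trans T.le_succ) = restr Ω₁ t hT ∘ restr Ω₁ T T.le_succ := rfl
    rw [this, ← Measure.map_map (measurable_restr _ _) (measurable_restr _ _),
      map_restr_compProd, hPν]

/-- Marginals of measures up to time `T` belong to the family at time `t`. -/
theorem map_restr_mem_measFam {Pt : (t : ℕ) → (Fin t → Ω₁) → Set (ProbabilityMeasure Ω₁)} {T : ℕ}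
    {t : ℕ} (ht : t ≤ T) {P : Measure (Fin T → Ω₁)} (hP : P ∈ MeasFam Ω₁ Pt T) :
    P.map (restr Ω₁ t ht) ∈ MeasFam Ω₁ Pt t := by
  induction T, ht using Nat.le_induction with
  | base => exact (Measure.map_id (μ := P)).symm ▸ hP
  | succ T hT ih =>
    obtain ⟨ν, hν, κ, hκ, hκP, h⟩ := exists_kernel_of_mem_measFam_succ hP
    have := isProbabilityMeasure_of_mem_measFam hν
    obtain ⟨η, _, hη⟩ := exists_kernel_ae_eq ν hκ
    rw [h η inferInstance hη]
    have : restr Ω₁ t (hT.trans T.le_succ) = restr Ω₁ t hT ∘ restr Ω₁ T T.le_succ := rfl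
    rw [this, ← Measure.map_map (measurable_restr _ _) (measurable_restr _ _),
      map_restr_compProd]
    exact ih hν

end Paths

/-! ### Martingale measures exclude arbitrage -/

section AbstractMartingale

variable {Ω : Type*} {m m0 : MeasurableSpace Ω} {Q : Measure Ω} [IsProbabilityMeasure Q] {d : ℕ}

theorem integral_sum_mul_eq_zero (hm : m ≤ m0) {X : Ω → Fin d → ℝ}
    (hX : ∀ i, Integrable (fun ω => X ω i) Q)
    (hX0 : ∀ i A, MeasurableSet[m] A → ∫ ω in A, X ω i ∂Q = 0)
    {k : Ω → Fin d → ℝ} (hk : Measurable[m] k) {c : ℝ} (hc : ∀ ω i, |k ω i| ≤ c) :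
    Integrable (fun ω => ∑ i, k ω i * X ω i) Q ∧ ∫ ω, ∑ i, k ω i * X ω i ∂Q = 0 := by
  have hki : ∀ i, Measurable[m] fun ω => k ω i := fun i => (measurable_pi_apply i).comp hk
  have hintg : ∀ i, Integrable (fun ω => k ω i * X ω i) Q := fun i =>
    (hX i).bdd_mul (c := c) ((hki i).mono hm le_rfl).aestronglyMeasurable
      (Eventually.of_forall fun ω => hc ω i)
  refine ⟨integrable_finsetSum _ fun i _ => hintg i, ?_⟩
  rw [integral_finsetSum _ fun i _ => hintg i]
  refine Finset.sum_eq_zero fun i _ => ?_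
  have h0 : Q[fun ω => X ω i | m] =ᵐ[Q] 0 := by
    symm
    refine ae_eq_condExp_of_forall_setIntegral_eq hm (hX i) (fun _ _ _ => integrableOn_zero) ?_
      stronglyMeasurable_zero.aestronglyMeasurable
    intro s hs _
    rw [hX0 i s hs]
    simp
  have h1 : Q[(fun ω => k ω i) * (fun ω => X ω i) | m] =ᵐ[Q] 0 := by
    refine (condExp_mul_of_stronglyMeasurable_left (hki i).stronglyMeasurable (hintg i) (hX i)).trans
      ?_
    filter_upwards [h0] with ω hω
    simp [hω]
  calc ∫ ω, k ω i * X ω i ∂Q = ∫ ω, (Q[(fun ω => k ω i) * (fun ω => X ω i) | m]) ω ∂Q :=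
        (integral_condExp hm).symm
    _ = 0 := by rw [integral_congr_ae h1]; simp

theorem ae_nonneg_of_ae_nonneg_add (hm : m ≤ m0) {X : Ω → Fin d → ℝ}
    (hX : ∀ i, Integrable (fun ω => X ω i) Q)
    (hX0 : ∀ i A, MeasurableSet[m] A → ∫ ω in A, X ω i ∂Q = 0)
    {G : Ω → ℝ} (hG : Measurable[m] G) {k : Ω → Fin d → ℝ} (hk : Measurable[m] k)
    (h : ∀ᵐ ω ∂Q, 0 ≤ G ω + ∑ i, k ω i * X ω i) : ∀ᵐ ω ∂Q, 0 ≤ G ω := by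
  have hki : ∀ i, Measurable[m] fun ω => k ω i := fun i => (measurable_pi_apply i).comp hk
  have key : ∀ n : ℕ, ∀ᵐ ω ∂Q, ¬ (G ω < 0 ∧ -(n : ℝ) ≤ G ω ∧ ∀ i, |k ω i| ≤ n) := by
    intro n
    let A : Set Ω := {ω | G ω < 0 ∧ -(n : ℝ) ≤ G ω ∧ ∀ i, |k ω i| ≤ n}
    have hA : MeasurableSet[m] A := by
      refine (hG measurableSet_Iio).inter ((hG measurableSet_Ici).inter ?_)
      have : {ω | ∀ i, |k ω i| ≤ n} = ⋂ i, {ω | |k ω i| ≤ n} := by ext; simp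
      change MeasurableSet[m] {ω | ∀ i, |k ω i| ≤ n}
      rw [this]
      exact MeasurableSet.iInter fun i =>
        (measurable_norm.comp (hki i)) (measurableSet_Iic (a := (n : ℝ)))
    have hkA : Measurable[m] (A.indicator k) := hk.indicator hA
    obtain ⟨h1, h2⟩ := integral_sum_mul_eq_zero (c := n) hm hX hX0 hkA (fun ω i => by
      by_cases hω : ω ∈ A
      · simpa [hω] using hω.2.2 i
      · simp [hω])
    have hGA : Integrable (A.indicator G) Q := by
      refine Integrable.of_bound (C := n)
        ((hG.indicator hA).mono hm le_rfl).aestronglyMeasurable (Eventually.of_forall fun ω => ?_)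
      by_cases hω : ω ∈ A
      · simp only [hω, indicator_of_mem, Real.norm_eq_abs]
        rw [abs_le]
        exact ⟨hω.2.1, hω.1.le.trans (Nat.cast_nonneg n)⟩
      · simp [hω]
    have h3 : 0 ≤ ∫ ω, A.indicator G ω ∂Q := by
      have : 0 ≤ ∫ ω, (A.indicator G ω + ∑ i, A.indicator k ω i * X ω i) ∂Q := by
        refine integral_nonneg_of_ae ?_
        filter_upwards [h] with ω hω
        by_cases hωA : ω ∈ A
        · simpa [hωA] using hω
        · simp [hωA]
      rwa [integral_add hGA h1, h2, add_zero] at this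
    have h4 : 0 ≤ᵐ[Q] fun ω => -(A.indicator G ω) := Eventually.of_forall fun ω => by
      by_cases hω : ω ∈ A
      · simpa [hω] using hω.1.le
      · simp [hω]
    have h5 : ∫ ω, -(A.indicator G ω) ∂Q = 0 := by
      refine le_antisymm ?_ (integral_nonneg_of_ae h4)
      rw [integral_neg]; linarith
    have h6 := (integral_eq_zero_iff_of_nonneg_ae h4 hGA.neg).1 h5
    filter_upwards [h6] with ω hω hωA
    have hmem : ω ∈ A := hωA
    have : -(A.indicator G ω) = 0 := hω
    rw [indicator_of_mem hmem] at this
    linarith [hωA.1]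
  filter_upwards [ae_all_iff.2 key] with ω hω
  by_contra hneg
  push Not at hneg
  obtain ⟨n, hn⟩ := exists_nat_ge (|G ω| + ∑ i, |k ω i|)
  have hs : 0 ≤ ∑ i, |k ω i| := Finset.sum_nonneg fun i _ => abs_nonneg _
  refine hω n ⟨hneg, ?_, fun i => ?_⟩
  · linarith [neg_abs_le (G ω)]
  · have := Finset.single_le_sum (f := fun i => |k ω i|) (fun i _ => abs_nonneg _)
      (Finset.mem_univ i)
    linarith [abs_nonneg (G ω)]

theorem ae_eq_zero_of_ae_nonneg (hm : m ≤ m0) {X : Ω → Fin d → ℝ}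
    (hX : ∀ i, Integrable (fun ω => X ω i) Q)
    (hX0 : ∀ i A, MeasurableSet[m] A → ∫ ω in A, X ω i ∂Q = 0)
    {k : Ω → Fin d → ℝ} (hk : Measurable[m] k)
    (h : ∀ᵐ ω ∂Q, 0 ≤ ∑ i, k ω i * X ω i) : ∀ᵐ ω ∂Q, ∑ i, k ω i * X ω i = 0 := by
  have hki : ∀ i, Measurable[m] fun ω => k ω i := fun i => (measurable_pi_apply i).comp hk
  have key : ∀ n : ℕ, ∀ᵐ ω ∂Q, (∀ i, |k ω i| ≤ n) → ∑ i, k ω i * X ω i = 0 := by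
    intro n
    let A : Set Ω := {ω | ∀ i, |k ω i| ≤ n}
    have hA : MeasurableSet[m] A := by
      have : A = ⋂ i, {ω | |k ω i| ≤ n} := by ext; simp [A]
      rw [this]
      exact MeasurableSet.iInter fun i =>
        (measurable_norm.comp (hki i)) (measurableSet_Iic (a := (n : ℝ)))
    obtain ⟨h1, h2⟩ := integral_sum_mul_eq_zero (c := n) hm hX hX0 (hk.indicator hA) (fun ω i => by
      by_cases hω : ω ∈ A
      · simpa [hω] using hω i
      · simp [hω])
    have h4 : 0 ≤ᵐ[Q] fun ω => ∑ i, A.indicator k ω i * X ω i := by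
      filter_upwards [h] with ω hω
      by_cases hωA : ω ∈ A
      · simpa [hωA] using hω
      · simp [hωA]
    filter_upwards [(integral_eq_zero_iff_of_nonneg_ae h4 h1).1 h2] with ω hω hωA
    have hmem : ω ∈ A := hωA
    simpa [hmem] using hω
  filter_upwards [ae_all_iff.2 key] with ω hω
  obtain ⟨n, hn⟩ := exists_nat_ge (∑ i, |k ω i|)
  exact hω n fun i => (Finset.single_le_sum (f := fun i => |k ω i|) (fun i _ => abs_nonneg _)
      (Finset.mem_univ i)).trans hn

end AbstractMartingale

section Gain

variable {Ω₁ : Type} [MeasurableSpace Ω₁] {T d : ℕ} {S : (t : ℕ) → (Fin t → Ω₁) → Fin d → ℝ}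

theorem gain_succ (H : (u : ℕ) → (Fin u → Ω₁) → Fin d → ℝ) (t : ℕ) (ht : t + 1 ≤ T)
    (ω : Fin T → Ω₁) :
    gain Ω₁ S H (t + 1) ht ω = gain Ω₁ S H t (t.le_succ.trans ht) ω +
      ∑ i, H t (restr Ω₁ t (t.le_succ.trans ht) ω) i *
        (S (t + 1) (restr Ω₁ (t + 1) ht ω) i - S t (restr Ω₁ t (t.le_succ.trans ht) ω) i) := by
  simp only [gain, Fin.sum_univ_castSucc]
  rfl

theorem measurable_gain_of_le (hS : ∀ t ≤ T, Measurable (S t))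
    {H : (u : ℕ) → (Fin u → Ω₁) → Fin d → ℝ} (m : MeasurableSpace (Fin T → Ω₁)) {t : ℕ}
    (ht : t ≤ T) (hr : ∀ u (hu : u ≤ t), Measurable[m] (restr Ω₁ u (hu.trans ht)))
    (hH : ∀ u (hu : u < t), Measurable[m] fun ω => H u (restr Ω₁ u (hu.le.trans ht) ω)) :
    Measurable[m] (gain Ω₁ S H t ht) := by
  refine Finset.measurable_sum _ fun u _ => Finset.measurable_sum _ fun i _ => ?_
  refine ((measurable_pi_apply i).comp (hH u u.2)).mul (Measurable.sub ?_ ?_)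
  · exact (measurable_pi_apply i).comp ((hS _ (Nat.succ_le_of_lt (u.2.trans_le ht))).comp (hr _ u.2))
  · exact (measurable_pi_apply i).comp ((hS _ (u.2.le.trans ht)).comp (hr _ u.2.le))

theorem measurable_restr_univComp {t : ℕ} (ht : t ≤ T) :
    Measurable[univComp (Fin T → Ω₁), univComp (Fin t → Ω₁)] (restr Ω₁ t ht) := by
  intro s hs μ hμ
  have hr := measurable_restr (Ω₁ := Ω₁) t ht
  exact (hs (μ.map (restr Ω₁ t ht)) (Measure.isProbabilityMeasure_map hr.aemeasurable)).preimage
    ⟨hr, Measure.AbsolutelyContinuous.rfl⟩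

theorem measurable_univComp_gain (hS : ∀ t ≤ T, Measurable (S t))
    {H : (u : ℕ) → (Fin u → Ω₁) → Fin d → ℝ} (hH : Pred Ω₁ d H) {t : ℕ} (ht : t ≤ T) :
    Measurable[univComp (Fin T → Ω₁)] (gain Ω₁ S H t ht) :=
  measurable_gain_of_le hS _ ht (fun u hu => (measurable_restr u (hu.trans ht)).mono
    le_univComp le_rfl) fun u hu => (hH u).comp (measurable_restr_univComp (hu.le.trans ht))

theorem gain_ae_eq_zero_of_borel (hS : ∀ t ≤ T, Measurable (S t)) {Q : Measure (Fin T → Ω₁)}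
    [IsProbabilityMeasure Q] (hQ : IsMartMeas Ω₁ S Q)
    {H : (u : ℕ) → (Fin u → Ω₁) → Fin d → ℝ} (hH : ∀ u, Measurable (H u)) {t : ℕ} (ht : t ≤ T)
    (h : ∀ᵐ ω ∂Q, 0 ≤ gain Ω₁ S H t ht ω) : ∀ᵐ ω ∂Q, gain Ω₁ S H t ht ω = 0 := by
  induction t with
  | zero => exact Eventually.of_forall fun ω => by simp [gain]
  | succ t ih =>
    have ht' : t ≤ T := t.le_succ.trans ht
    let m : MeasurableSpace (Fin T → Ω₁) := MeasurableSpace.comap (restr Ω₁ t ht') inferInstance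
    have hm : m ≤ MeasurableSpace.pi := (measurable_restr t ht').comap_le
    have hmf : m ≤ filtr Ω₁ T t ht' := MeasurableSpace.comap_mono le_univComp
    have hrm : Measurable[m] (restr Ω₁ t ht') := comap_measurable _
    have hr : ∀ u (hu : u ≤ t), Measurable[m] (restr Ω₁ u (hu.trans ht')) := fun u hu =>
      (measurable_restr u hu).comp hrm
    let X : (Fin T → Ω₁) → Fin d → ℝ := fun ω i =>
      S (t + 1) (restr Ω₁ (t + 1) ht ω) i - S t (restr Ω₁ t ht' ω) i
    have hX : ∀ i, Integrable (fun ω => X ω i) Q := fun i =>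
      (hQ.1 (t + 1) ht i).sub (hQ.1 t ht' i)
    have hX0 : ∀ i A, MeasurableSet[m] A → ∫ ω in A, X ω i ∂Q = 0 := fun i A hA => by
      rw [integral_sub (hQ.1 (t + 1) ht i).integrableOn (hQ.1 t ht' i).integrableOn,
        hQ.2 t ht i A (hmf A hA), sub_self]
    have hk : Measurable[m] fun ω => H t (restr Ω₁ t ht' ω) := (hH t).comp hrm
    have hG : Measurable[m] (gain Ω₁ S H t ht') := measurable_gain_of_le hS m ht' hr
      fun u hu => (hH u).comp (hr u hu.le)
    have h' : ∀ᵐ ω ∂Q, 0 ≤ gain Ω₁ S H t ht' ω + ∑ i, H t (restr Ω₁ t ht' ω) i * X ω i := by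
      filter_upwards [h] with ω hω
      rwa [gain_succ] at hω
    have h0 := ih ht' (ae_nonneg_of_ae_nonneg_add hm hX hX0 hG hk h')
    have h1 : ∀ᵐ ω ∂Q, ∑ i, H t (restr Ω₁ t ht' ω) i * X ω i = 0 := by
      refine ae_eq_zero_of_ae_nonneg hm hX hX0 hk ?_
      filter_upwards [h0, h'] with ω h0 h'
      rwa [h0, zero_add] at h'
    filter_upwards [h0, h1] with ω h0 h1
    rw [gain_succ, h0, zero_add]
    exact h1

/-- Under a martingale measure, a nonnegative gain vanishes. -/
theorem gain_ae_eq_zero (hS : ∀ t ≤ T, Measurable (S t)) {Q : Measure (Fin T → Ω₁)}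
    [IsProbabilityMeasure Q] (hQ : IsMartMeas Ω₁ S Q)
    {H : (u : ℕ) → (Fin u → Ω₁) → Fin d → ℝ} (hH : Pred Ω₁ d H)
    (h : ∀ᵐ ω ∂Q, 0 ≤ gain Ω₁ S H T le_rfl ω) : ∀ᵐ ω ∂Q, gain Ω₁ S H T le_rfl ω = 0 := by
  have hex : ∀ u, ∃ k : (Fin u → Ω₁) → Fin d → ℝ, Measurable k ∧
      ∀ hu : u ≤ T, ∀ᵐ ω ∂Q, H u (restr Ω₁ u hu ω) = k (restr Ω₁ u hu ω) := by
    intro u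
    by_cases hu : u ≤ T
    · have := Measure.isProbabilityMeasure_map (μ := Q) (measurable_restr (Ω₁ := Ω₁) u hu).aemeasurable
      obtain ⟨k, hk, hHk⟩ := aemeasurable_of_univComp (hH u) (Q.map (restr Ω₁ u hu))
      exact ⟨k, hk, fun _ => ae_of_ae_map (measurable_restr u hu).aemeasurable hHk⟩
    · exact ⟨0, measurable_zero, fun h => absurd h hu⟩
  choose k hk hHk using hex
  have heq : ∀ᵐ ω ∂Q, gain Ω₁ S H T le_rfl ω = gain Ω₁ S k T le_rfl ω := by
    have : ∀ᵐ ω ∂Q, ∀ u : Fin T, H u (restr Ω₁ u u.2.le ω) = k u (restr Ω₁ u u.2.le ω) :=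
      ae_all_iff.2 fun u => hHk u u.2.le
    filter_upwards [this] with ω hω
    simp only [gain, hω]
  have h' : ∀ᵐ ω ∂Q, 0 ≤ gain Ω₁ S k T le_rfl ω := by
    filter_upwards [h, heq] with ω h1 h2
    rwa [← h2]
  filter_upwards [heq, gain_ae_eq_zero_of_borel hS hQ hk le_rfl h'] with ω h1 h2
  rw [h1, h2]

/-- If every measure is dominated by a martingale measure, there is no arbitrage. -/
theorem noArbitrage_of_dominated [TopologicalSpace Ω₁] [OpensMeasurableSpace Ω₁]
    (hS : ∀ t ≤ T, Measurable (S t))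
    {PP : Set (Measure (Fin T → Ω₁))} {g : Fin 0 → (Fin T → Ω₁) → ℝ}
    (hPP : ∀ P ∈ PP, ∃ Q ∈ QSet Ω₁ PP S g, P ≪ Q) : NA Ω₁ PP S g := by
  intro H hH h hnn
  simp only [Finset.univ_eq_empty, Finset.sum_empty, add_zero] at hnn ⊢
  obtain ⟨A, hA, hAsub, hA0⟩ := hnn
  refine ⟨{ω | ¬ gain Ω₁ S H T le_rfl ω = 0}, ?_, subset_rfl, fun P hP => ?_⟩
  · exact (measurable_univComp_gain hS hH le_rfl) (measurableSet_singleton 0).compl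
  · obtain ⟨Q, ⟨hQp, ⟨P', hP', hQP'⟩, hQm, -⟩, hPQ⟩ := hPP P hP
    refine hPQ ?_
    have : ∀ᵐ ω ∂Q, 0 ≤ gain Ω₁ S H T le_rfl ω := by
      have : Q A = 0 := hQP' (hA0 P' hP')
      exact measure_mono_null hAsub this
    exact gain_ae_eq_zero hS hQm hH this

end Gain

/-! ### One-period markets -/

section OnePeriodBasics

variable {E : Type*} [MeasurableSpace E] {d : ℕ} {X : E → Fin d → ℝ}

theorem measurable_const_dotProduct (hX : Measurable X) (y : Fin d → ℝ) :
    Measurable fun x => y ⬝ᵥ X x :=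
  Finset.measurable_sum _ fun i _ => measurable_const.mul ((measurable_pi_apply i).comp hX)

theorem continuous_dotProduct_const (x : Fin d → ℝ) : Continuous fun y : Fin d → ℝ => y ⬝ᵥ x :=
  continuous_finsetSum _ fun i _ => (continuous_apply i).mul continuous_const

theorem quasiSure_iff {PP : Set (Measure E)} {p : E → Prop} (hp : MeasurableSet {x | p x}) :
    QuasiSure PP ‹MeasurableSpace E› p ↔ ∀ P ∈ PP, ∀ᵐ x ∂P, p x := by
  constructor
  · rintro ⟨A, -, hA, h⟩ P hP
    exact measure_mono_null hA (h P hP)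
  · exact fun h => ⟨{x | ¬ p x}, hp.compl, subset_rfl, h⟩

theorem na1_iff (hX : Measurable X) {PP : Set (Measure E)} :
    NA1 PP X ↔ ∀ y : Fin d → ℝ, (∀ P ∈ PP, ∀ᵐ x ∂P, 0 ≤ y ⬝ᵥ X x) →
      ∀ P ∈ PP, ∀ᵐ x ∂P, y ⬝ᵥ X x = 0 := by
  refine forall_congr' fun y => ?_
  have h := measurable_const_dotProduct hX y
  exact imp_congr (quasiSure_iff (h measurableSet_Ici))
    (quasiSure_iff (h (measurableSet_singleton 0)))

theorem isClosed_setOf_ae_nonneg (P : Measure E) :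
    IsClosed {y : Fin d → ℝ | ∀ᵐ x ∂P, 0 ≤ y ⬝ᵥ X x} := by
  refine IsSeqClosed.isClosed fun u y hu hy => ?_
  have : ∀ᵐ x ∂P, ∀ n, 0 ≤ u n ⬝ᵥ X x := ae_all_iff.2 hu
  filter_upwards [this] with x hx
  exact ge_of_tendsto' ((continuous_dotProduct_const (X x)).continuousAt.tendsto.comp hy) hx

/-- The subspace of portfolios with vanishing return. -/
def nullPortfolios (PP : Set (Measure E)) (X : E → Fin d → ℝ) : Submodule ℝ (Fin d → ℝ) where
  carrier := {y | ∀ P ∈ PP, ∀ᵐ x ∂P, y ⬝ᵥ X x = 0}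
  zero_mem' := fun P _ => Eventually.of_forall fun x => zero_dotProduct _
  add_mem' := fun ha hb P hP => by
    filter_upwards [ha P hP, hb P hP] with x h1 h2
    rw [add_dotProduct, h1, h2, add_zero]
  smul_mem' := fun c y hy P hP => by
    filter_upwards [hy P hP] with x hx
    rw [smul_dotProduct, hx, smul_zero]

theorem ConvexPM.exists_dominating {𝒞 : Set (ProbabilityMeasure E)} (h𝒞 : ConvexPM 𝒞)
    {P P' : ProbabilityMeasure E} (hP : P ∈ 𝒞) (hP' : P' ∈ 𝒞) :
    ∃ R ∈ 𝒞, (P : Measure E) ≪ R ∧ (P' : Measure E) ≪ R := by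
  have h2 : (2⁻¹ : ℝ≥0∞) ≠ 0 := by simp
  let ξ : Measure E := (2⁻¹ : ℝ≥0∞) • (P : Measure E) + (2⁻¹ : ℝ≥0∞) • (P' : Measure E)
  have hξ : IsProbabilityMeasure ξ := ⟨by simp [ξ, ENNReal.inv_two_add_inv_two]⟩
  refine ⟨⟨ξ, hξ⟩, h𝒞 P hP P' hP' _ _ ENNReal.inv_two_add_inv_two _ rfl, ?_, ?_⟩
  · exact (Measure.absolutelyContinuous_smul h2).trans
      (Measure.AbsolutelyContinuous.rfl.add_right _)
  · refine (Measure.absolutelyContinuous_smul h2).trans ?_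
    change (2⁻¹ : ℝ≥0∞) • (P' : Measure E) ≪ ξ
    simp only [ξ]
    rw [add_comm]
    exact Measure.AbsolutelyContinuous.rfl.add_right _

/-- On a compact set of portfolios, a single measure can witness all possible losses. -/
theorem exists_mem_forall_compact {𝒞 : Set (ProbabilityMeasure E)} (h𝒞 : ConvexPM 𝒞)
    {P₀ : ProbabilityMeasure E} (hP₀ : P₀ ∈ 𝒞) {K : Set (Fin d → ℝ)} (hK : IsCompact K)
    (hloss : ∀ y ∈ K, ∃ P ∈ 𝒞, ¬ ∀ᵐ x ∂(P : Measure E), 0 ≤ y ⬝ᵥ X x) :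
    ∃ R ∈ 𝒞, (P₀ : Measure E) ≪ R ∧ ∀ y ∈ K, ¬ ∀ᵐ x ∂(R : Measure E), 0 ≤ y ⬝ᵥ X x := by
  refine hK.induction_on (p := fun s => ∃ R ∈ 𝒞, (P₀ : Measure E) ≪ R ∧
    ∀ y ∈ s, ¬ ∀ᵐ x ∂(R : Measure E), 0 ≤ y ⬝ᵥ X x) ?_ ?_ ?_ ?_
  · exact ⟨P₀, hP₀, Measure.AbsolutelyContinuous.rfl, by simp⟩
  · rintro s t hst ⟨R, hR, h0, h⟩
    exact ⟨R, hR, h0, fun y hy => h y (hst hy)⟩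
  · rintro s t ⟨R, hR, h0, h⟩ ⟨R', hR', -, h'⟩
    obtain ⟨R'', hR'', h1, h2⟩ := h𝒞.exists_dominating hR hR'
    refine ⟨R'', hR'', h0.trans h1, ?_⟩
    rintro y (hy | hy) hae
    · exact h y hy (h1.ae_le hae)
    · exact h' y hy (h2.ae_le hae)
  · intro y hy
    obtain ⟨P, hP, hneg⟩ := hloss y hy
    obtain ⟨R, hR, h1, h2⟩ := h𝒞.exists_dominating hP₀ hP
    refine ⟨{z | ∀ᵐ x ∂(R : Measure E), 0 ≤ z ⬝ᵥ X x}ᶜ, ?_, R, hR, h1, fun z hz => hz⟩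
    exact mem_nhdsWithin_of_mem_nhds ((isClosed_setOf_ae_nonneg _).isOpen_compl.mem_nhds
      fun hae => hneg (h2.ae_le hae))

/-- Under the one-period no-arbitrage condition, every model is dominated by an arbitrage-free
one. -/
theorem exists_dominating_noArbitrage (hX : Measurable X) {𝒞 : Set (ProbabilityMeasure E)}
    (h𝒞 : ConvexPM 𝒞) {P₀ : ProbabilityMeasure E} (hP₀ : P₀ ∈ 𝒞)
    (hNA : NA1 ((fun P : ProbabilityMeasure E => (P : Measure E)) '' 𝒞) X) :
    ∃ R ∈ 𝒞, (P₀ : Measure E) ≪ R ∧ ∀ y : Fin d → ℝ, (∀ᵐ x ∂(R : Measure E), 0 ≤ y ⬝ᵥ X x) →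
      ∀ᵐ x ∂(R : Measure E), y ⬝ᵥ X x = 0 := by
  set PP := (fun P : ProbabilityMeasure E => (P : Measure E)) '' 𝒞 with hPP
  rw [na1_iff hX] at hNA
  obtain ⟨M, hM⟩ := Submodule.exists_isCompl (nullPortfolios PP X)
  have hK : IsCompact (Metric.sphere (0 : Fin d → ℝ) 1 ∩ M) :=
    (isCompact_sphere _ _).inter_right M.closed_of_finiteDimensional
  obtain ⟨R, hR, h0, hRK⟩ := exists_mem_forall_compact (X := X) h𝒞 hP₀ hK (by
    rintro y ⟨hy1, hyM⟩
    by_contra hcon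
    push Not at hcon
    have hyN : y ∈ nullPortfolios PP X := by
      refine hNA y ?_
      rintro _ ⟨P, hP, rfl⟩
      exact hcon P hP
    have : y = 0 := (Submodule.disjoint_def.1 hM.disjoint) y hyN hyM
    rw [this] at hy1
    simp at hy1)
  refine ⟨R, hR, h0, fun y hy => ?_⟩
  obtain ⟨n, hn, z, hz, rfl⟩ : ∃ n ∈ nullPortfolios PP X, ∃ z ∈ M, n + z = y :=
    Submodule.mem_sup.1 (hM.sup_eq_top ▸ Submodule.mem_top)
  have hn0 := hn R ⟨R, hR, rfl⟩
  have hz0 : z = 0 := by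
    by_contra hne
    have hpos : 0 < ‖z‖ := norm_pos_iff.2 hne
    refine hRK (‖z‖⁻¹ • z) ⟨?_, M.smul_mem _ hz⟩ ?_
    · simp [norm_smul, hpos.ne']
    · filter_upwards [hn0, hy] with x h1 h2
      rw [add_dotProduct, h1, zero_add] at h2
      rw [smul_dotProduct]
      exact mul_nonneg (inv_nonneg.2 hpos.le) h2
  filter_upwards [hn0] with x h1
  rw [hz0, add_zero, h1]

end OnePeriodBasics

section Density

/-- The derivative of `s ↦ s - √(1 + s²)`, a positive bounded function. -/
def rho (s : ℝ) : ℝ := 1 - s / √(1 + s ^ 2)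

theorem sqrt_one_add_sq_pos (s : ℝ) : 0 < √(1 + s ^ 2) := Real.sqrt_pos.2 (by positivity)

theorem abs_lt_sqrt_one_add_sq (s : ℝ) : |s| < √(1 + s ^ 2) := by
  rw [← Real.sqrt_sq_eq_abs]
  exact Real.sqrt_lt_sqrt (sq_nonneg s) (by linarith)

theorem rho_pos (s : ℝ) : 0 < rho s := by
  have := (le_abs_self s).trans_lt (abs_lt_sqrt_one_add_sq s)
  rw [rho, sub_pos, div_lt_one (sqrt_one_add_sq_pos s)]
  exact this

theorem rho_le_two (s : ℝ) : rho s ≤ 2 := by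
  have h1 := (neg_le_abs s).trans_lt (abs_lt_sqrt_one_add_sq s)
  have : -1 ≤ s / √(1 + s ^ 2) := by
    rw [le_div_iff₀ (sqrt_one_add_sq_pos s)]; linarith
  rw [rho]; linarith

theorem continuous_rho : Continuous rho :=
  continuous_const.sub (continuous_id.div (by fun_prop) fun s => (sqrt_one_add_sq_pos s).ne')

/-- The primitive of `-rho`. -/
def psi (s : ℝ) : ℝ := √(1 + s ^ 2) - s

theorem hasDerivAt_psi (s : ℝ) : HasDerivAt psi (-rho s) s := by
  have h1 : HasDerivAt (fun s : ℝ => 1 + s ^ 2) (2 * s) s := by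
    simpa using (hasDerivAt_pow 2 s).const_add 1
  have h2 := (h1.sqrt (by positivity)).sub (hasDerivAt_id s)
  refine h2.congr_deriv ?_
  rw [rho, mul_div_mul_left _ _ two_ne_zero]
  ring

theorem psi_nonneg (s : ℝ) : 0 ≤ psi s :=
  sub_nonneg.2 ((le_abs_self s).trans (abs_lt_sqrt_one_add_sq s).le)

theorem continuous_psi : Continuous psi := by unfold psi; fun_prop

theorem max_neg_le_psi (s : ℝ) : max (-s) 0 ≤ psi s := by
  refine max_le ?_ (psi_nonneg s)
  have := Real.sqrt_nonneg (1 + s ^ 2)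
  rw [psi]; linarith

theorem abs_psi_sub_le (s r : ℝ) : |psi s - psi r| ≤ 2 * |s - r| := by
  have := Convex.norm_image_sub_le_of_norm_hasDerivWithin_le (f := psi) (f' := fun s => -rho s)
    (s := univ) (C := 2) (fun x _ => (hasDerivAt_psi x).hasDerivWithinAt)
    (fun x _ => by rw [norm_neg, Real.norm_of_nonneg (rho_pos x).le]; exact rho_le_two x)
    convex_univ (mem_univ r) (mem_univ s)
  simpa using this

end Density

section Rogers

variable {E : Type*} [MeasurableSpace E] {d : ℕ} {X : E → Fin d → ℝ} {w : E → ℝ}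

theorem mul_abs_dotProduct_le {x v : Fin d → ℝ} {c : ℝ} (hc : 0 ≤ c) (hx : ∀ i, c * |x i| ≤ 1) :
    c * |v ⬝ᵥ x| ≤ d * ‖v‖ := by
  calc c * |v ⬝ᵥ x| ≤ c * ∑ i, |v i * x i| :=
        mul_le_mul_of_nonneg_left (Finset.abs_sum_le_sum_abs _ _) hc
    _ = ∑ i, |v i| * (c * |x i|) := by
        rw [Finset.mul_sum]
        exact Finset.sum_congr rfl fun i _ => by rw [abs_mul]; ring
    _ ≤ ∑ _i : Fin d, ‖v‖ := Finset.sum_le_sum fun i _ => by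
        have h1 : |v i| ≤ ‖v‖ := norm_le_pi_norm v i
        calc |v i| * (c * |x i|) ≤ |v i| * 1 := mul_le_mul_of_nonneg_left (hx i) (abs_nonneg _)
          _ ≤ ‖v‖ := by rwa [mul_one]
    _ = d * ‖v‖ := by simp

variable {μ : Measure E} [IsFiniteMeasure μ]

theorem integrable_weight_comp (hX : Measurable X) (hw : Measurable w) (hw0 : ∀ x, 0 < w x)
    (hw1 : ∀ x, w x ≤ 1) (hwX : ∀ x i, w x * |X x i| ≤ 1) {φ : ℝ → ℝ} (hφ : Continuous φ)
    (hφL : ∀ s r, |φ s - φ r| ≤ 2 * |s - r|) (y : Fin d → ℝ) :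
    Integrable (fun x => w x * φ (y ⬝ᵥ X x)) μ := by
  refine Integrable.of_bound (C := |φ 0| + 2 * (d * ‖y‖))
    (hw.mul (hφ.measurable.comp (measurable_const_dotProduct hX y))).aestronglyMeasurable
    (Eventually.of_forall fun x => ?_)
  rw [Real.norm_eq_abs, abs_mul, abs_of_pos (hw0 x)]
  have h1 := hφL (y ⬝ᵥ X x) 0
  rw [sub_zero] at h1
  have h2 := abs_sub_abs_le_abs_sub (φ (y ⬝ᵥ X x)) (φ 0)
  have h3 := mul_abs_dotProduct_le (v := y) (hw0 x).le (hwX x)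
  calc w x * |φ (y ⬝ᵥ X x)| ≤ w x * (|φ 0| + 2 * |y ⬝ᵥ X x|) :=
        mul_le_mul_of_nonneg_left (by linarith) (hw0 x).le
    _ = w x * |φ 0| + 2 * (w x * |y ⬝ᵥ X x|) := by ring
    _ ≤ 1 * |φ 0| + 2 * (d * ‖y‖) := add_le_add
        (mul_le_mul_of_nonneg_right (hw1 x) (abs_nonneg _)) (by linarith)
    _ = _ := by rw [one_mul]

theorem continuous_integral_weight_comp (hX : Measurable X) (hw : Measurable w)
    (hw0 : ∀ x, 0 < w x) (hw1 : ∀ x, w x ≤ 1) (hwX : ∀ x i, w x * |X x i| ≤ 1) {φ : ℝ → ℝ}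
    (hφ : Continuous φ) (hφL : ∀ s r, |φ s - φ r| ≤ 2 * |s - r|) :
    Continuous fun y : Fin d → ℝ => ∫ x, w x * φ (y ⬝ᵥ X x) ∂μ := by
  refine (LipschitzWith.of_dist_le' (K := 2 * d * μ.real univ) fun y z => ?_).continuous
  rw [Real.dist_eq, ← integral_sub (integrable_weight_comp hX hw hw0 hw1 hwX hφ hφL y)
    (integrable_weight_comp hX hw hw0 hw1 hwX hφ hφL z), dist_eq_norm]
  have : ∀ᵐ x ∂μ, ‖w x * φ (y ⬝ᵥ X x) - w x * φ (z ⬝ᵥ X x)‖ ≤ 2 * d * ‖y - z‖ :=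
    Eventually.of_forall fun x => by
      rw [← mul_sub, Real.norm_eq_abs, abs_mul, abs_of_pos (hw0 x)]
      have h1 := hφL (y ⬝ᵥ X x) (z ⬝ᵥ X x)
      rw [← sub_dotProduct] at h1
      have h3 := mul_abs_dotProduct_le (v := y - z) (hw0 x).le (hwX x)
      have h4 := mul_le_mul_of_nonneg_left h1 (hw0 x).le
      linarith
  calc |∫ x, (w x * φ (y ⬝ᵥ X x) - w x * φ (z ⬝ᵥ X x)) ∂μ|
      ≤ 2 * d * ‖y - z‖ * μ.real univ := norm_integral_le_of_norm_le_const this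
    _ = _ := by ring

theorem abs_max_neg_sub_le (s r : ℝ) : |max (-s) 0 - max (-r) 0| ≤ 2 * |s - r| := by
  have h1 := abs_max_sub_max_le_abs (-s) (-r) 0
  have h2 : |-s - -r| = |s - r| := by rw [← abs_neg]; congr 1; ring
  rw [h2] at h1
  linarith [abs_nonneg (s - r)]

theorem continuous_max_neg : Continuous fun s : ℝ => max (-s) 0 := by fun_prop

theorem integral_weight_loss_pos_iff (hX : Measurable X) (hw : Measurable w)
    (hw0 : ∀ x, 0 < w x) (hw1 : ∀ x, w x ≤ 1) (hwX : ∀ x i, w x * |X x i| ≤ 1) (y : Fin d → ℝ) :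
    0 < ∫ x, w x * max (-(y ⬝ᵥ X x)) 0 ∂μ ↔ ¬ ∀ᵐ x ∂μ, 0 ≤ y ⬝ᵥ X x := by
  have hnn : ∀ x, 0 ≤ w x * max (-(y ⬝ᵥ X x)) 0 := fun x =>
    mul_nonneg (hw0 x).le (le_max_right _ _)
  rw [(integral_nonneg hnn).lt_iff_ne, ne_comm, not_iff_not, integral_eq_zero_iff_of_nonneg hnn
    (integrable_weight_comp hX hw hw0 hw1 hwX continuous_max_neg abs_max_neg_sub_le y)]
  refine eventually_congr (Eventually.of_forall fun x => ?_)
  simp [(hw0 x).ne']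

theorem exists_forall_integral_psi_le (hX : Measurable X) (hw : Measurable w)
    (hw0 : ∀ x, 0 < w x) (hw1 : ∀ x, w x ≤ 1) (hwX : ∀ x i, w x * |X x i| ≤ 1)
    (hNA : ∀ y : Fin d → ℝ, (∀ᵐ x ∂μ, 0 ≤ y ⬝ᵥ X x) → ∀ᵐ x ∂μ, y ⬝ᵥ X x = 0) :
    ∃ y : Fin d → ℝ, ∀ z : Fin d → ℝ,
      ∫ x, w x * psi (y ⬝ᵥ X x) ∂μ ≤ ∫ x, w x * psi (z ⬝ᵥ X x) ∂μ := by
  obtain ⟨M, hM⟩ := Submodule.exists_isCompl (nullPortfolios {μ} X)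
  let φ : ℝ → ℝ := fun s => max (-s) 0
  have hφ : Continuous φ := continuous_max_neg
  have hφL : ∀ s r, |φ s - φ r| ≤ 2 * |s - r| := abs_max_neg_sub_le
  have hφc := continuous_integral_weight_comp (μ := μ) hX hw hw0 hw1 hwX hφ hφL
  have hK : IsCompact (Metric.sphere (0 : Fin d → ℝ) 1 ∩ M) :=
    (isCompact_sphere _ _).inter_right M.closed_of_finiteDimensional
  have hpos : ∀ y ∈ Metric.sphere (0 : Fin d → ℝ) 1 ∩ M, 0 < ∫ x, w x * φ (y ⬝ᵥ X x) ∂μ := by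
    rintro y ⟨hy1, hyM⟩
    refine (integral_weight_loss_pos_iff hX hw hw0 hw1 hwX y).2 fun h => ?_
    have h2 := hNA y h
    have hyN : y ∈ nullPortfolios {μ} X := by
      rintro _ rfl
      exact h2
    have : y = 0 := (Submodule.disjoint_def.1 hM.disjoint) y hyN hyM
    rw [this] at hy1
    simp at hy1
  obtain ⟨ε, hε, hεK⟩ : ∃ ε > 0, ∀ y ∈ Metric.sphere (0 : Fin d → ℝ) 1 ∩ M,
      ε ≤ ∫ x, w x * φ (y ⬝ᵥ X x) ∂μ := by
    rcases (Metric.sphere (0 : Fin d → ℝ) 1 ∩ M).eq_empty_or_nonempty with h | h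
    · exact ⟨1, one_pos, by simp [h]⟩
    · obtain ⟨y, hy, hmin⟩ := hK.exists_isMinOn h hφc.continuousOn
      exact ⟨_, hpos y hy, fun z hz => hmin hz⟩
  have hψL := abs_psi_sub_le
  have hψi := integrable_weight_comp (μ := μ) hX hw hw0 hw1 hwX continuous_psi hψL
  have hlow : ∀ y ∈ M, ε * ‖y‖ ≤ ∫ x, w x * psi (y ⬝ᵥ X x) ∂μ := by
    intro y hy
    rcases eq_or_ne y 0 with rfl | hne
    · rw [norm_zero, mul_zero]
      exact integral_nonneg fun x => mul_nonneg (hw0 x).le (psi_nonneg _)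
    have hpos : 0 < ‖y‖ := norm_pos_iff.2 hne
    have h1 := hεK (‖y‖⁻¹ • y) ⟨by simp [norm_smul, hpos.ne'], M.smul_mem _ hy⟩
    calc ε * ‖y‖ ≤ (∫ x, w x * φ ((‖y‖⁻¹ • y) ⬝ᵥ X x) ∂μ) * ‖y‖ :=
          mul_le_mul_of_nonneg_right h1 hpos.le
      _ = ∫ x, w x * φ (y ⬝ᵥ X x) ∂μ := by
          rw [← integral_mul_const]
          refine integral_congr_ae (Eventually.of_forall fun x => ?_)
          simp only [smul_dotProduct, φ, smul_eq_mul]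
          rw [mul_assoc, max_mul_of_nonneg _ _ hpos.le]
          congr 2
          · field_simp
          · simp
      _ ≤ _ := integral_mono (integrable_weight_comp hX hw hw0 hw1 hwX hφ hφL y) (hψi y)
          fun x => mul_le_mul_of_nonneg_left (max_neg_le_psi _) (hw0 x).le
  let F : M → ℝ := fun y => ∫ x, w x * psi ((y : Fin d → ℝ) ⬝ᵥ X x) ∂μ
  have hFc : Continuous F := (continuous_integral_weight_comp (μ := μ) hX hw hw0 hw1 hwX
    continuous_psi hψL).comp continuous_subtype_val
  have hFt : Tendsto F (cocompact M) atTop :=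
    tendsto_atTop_mono (fun y => hlow y y.2) ((tendsto_norm_cocompact_atTop).const_mul_atTop hε)
  obtain ⟨y, hy⟩ := hFc.exists_forall_le hFt
  refine ⟨y, fun z => ?_⟩
  obtain ⟨n, hn, v, hv, rfl⟩ : ∃ n ∈ nullPortfolios {μ} X, ∃ v ∈ M, n + v = z :=
    Submodule.mem_sup.1 (hM.sup_eq_top ▸ Submodule.mem_top)
  refine (hy ⟨v, hv⟩).trans (le_of_eq (integral_congr_ae ?_))
  filter_upwards [hn μ rfl] with x hx
  simp only [add_dotProduct, hx, zero_add]

/-- In an arbitrage-free one-period model there is an equivalent martingale density of the form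
`w · rho (y ⬝ᵥ X)`. -/
theorem exists_integral_rho_eq_zero (hX : Measurable X) (hw : Measurable w)
    (hw0 : ∀ x, 0 < w x) (hw1 : ∀ x, w x ≤ 1) (hwX : ∀ x i, w x * |X x i| ≤ 1)
    (hNA : ∀ y : Fin d → ℝ, (∀ᵐ x ∂μ, 0 ≤ y ⬝ᵥ X x) → ∀ᵐ x ∂μ, y ⬝ᵥ X x = 0) :
    ∃ y : Fin d → ℝ, ∀ i, ∫ x, w x * rho (y ⬝ᵥ X x) * X x i ∂μ = 0 := by
  obtain ⟨y, hy⟩ := exists_forall_integral_psi_le hX hw hw0 hw1 hwX hNA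
  refine ⟨y, fun i => ?_⟩
  have hψi := integrable_weight_comp (μ := μ) hX hw hw0 hw1 hwX continuous_psi abs_psi_sub_le
  have hXi : Measurable fun x => X x i := (measurable_pi_apply i).comp hX
  have hdot : ∀ (s : ℝ) x, (y + s • Pi.single i 1) ⬝ᵥ X x = y ⬝ᵥ X x + s * X x i := fun s x => by
    rw [add_dotProduct, smul_dotProduct, single_one_dotProduct, smul_eq_mul]
  let F : ℝ → E → ℝ := fun s x => w x * psi (y ⬝ᵥ X x + s * X x i)
  let F' : ℝ → E → ℝ := fun s x => w x * (-rho (y ⬝ᵥ X x + s * X x i) * X x i)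
  have hFi : ∀ s, Integrable (F s) μ := fun s => by
    refine (hψi (y + s • Pi.single i 1)).congr (Eventually.of_forall fun x => ?_)
    simp only [F]
    rw [hdot s x]
  have hF'm : AEStronglyMeasurable (F' 0) μ := by
    have h1 : Measurable fun x => y ⬝ᵥ X x + 0 * X x i :=
      (measurable_const_dotProduct hX y).add (hXi.const_mul 0)
    have h2 : Measurable fun x => rho (y ⬝ᵥ X x + 0 * X x i) := continuous_rho.measurable.comp h1
    exact (hw.mul (h2.neg.mul hXi)).aestronglyMeasurable
  have hF'b : ∀ᵐ x ∂μ, ∀ s ∈ (univ : Set ℝ), ‖F' s x‖ ≤ 2 := by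
    refine Eventually.of_forall fun x s _ => ?_
    simp only [F']
    rw [Real.norm_eq_abs, abs_mul, abs_mul, abs_neg, abs_of_pos (hw0 x), abs_of_pos (rho_pos _)]
    have h3 := mul_nonneg (hw0 x).le (abs_nonneg (X x i))
    calc w x * (rho (y ⬝ᵥ X x + s * X x i) * |X x i|)
        = rho (y ⬝ᵥ X x + s * X x i) * (w x * |X x i|) := by ring
      _ ≤ 2 * 1 := mul_le_mul (rho_le_two _) (hwX x i) h3 zero_le_two
      _ = 2 := by norm_num
  have hFd : ∀ᵐ x ∂μ, ∀ s ∈ (univ : Set ℝ), HasDerivAt (F · x) (F' s x) s := by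
    refine Eventually.of_forall fun x s _ => ?_
    have h1 : HasDerivAt (fun s : ℝ => y ⬝ᵥ X x + s * X x i) (X x i) s := by
      simpa using ((hasDerivAt_id s).mul_const (X x i)).const_add (y ⬝ᵥ X x)
    exact ((hasDerivAt_psi _).comp s h1).const_mul (w x)
  have hder := (hasDerivAt_integral_of_dominated_loc_of_deriv_le (x₀ := (0 : ℝ)) univ_mem
    (Eventually.of_forall fun s => (hFi s).aestronglyMeasurable) (hFi 0) hF'm hF'b
    (integrable_const _) hFd).2
  have hmin : IsLocalMin (fun s : ℝ => ∫ x, F s x ∂μ) 0 := Eventually.of_forall fun s => by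
    have h1 : ∫ x, F s x ∂μ = ∫ x, w x * psi ((y + s • Pi.single i 1) ⬝ᵥ X x) ∂μ :=
      integral_congr_ae (Eventually.of_forall fun x => by simp only [F]; rw [hdot s x])
    have h2 : ∫ x, F 0 x ∂μ = ∫ x, w x * psi (y ⬝ᵥ X x) ∂μ :=
      integral_congr_ae (Eventually.of_forall fun x => by simp only [F, zero_mul, add_zero])
    change ∫ x, F 0 x ∂μ ≤ ∫ x, F s x ∂μ
    rw [h1, h2]
    exact hy (y + s • Pi.single i 1)
  have h0 := hmin.hasDerivAt_eq_zero hder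
  rw [← neg_eq_zero, ← integral_neg, ← h0]
  refine integral_congr_ae (Eventually.of_forall fun x => ?_)
  simp only [F', zero_mul, add_zero]
  ring

theorem ae_eq_zero_of_integral_rho_eq_zero (hX : Measurable X) (hw : Measurable w)
    (hw0 : ∀ x, 0 < w x) (hwX : ∀ x i, w x * |X x i| ≤ 1) {y : Fin d → ℝ}
    (hy : ∀ i, ∫ x, w x * rho (y ⬝ᵥ X x) * X x i ∂μ = 0) (z : Fin d → ℝ)
    (hz : ∀ᵐ x ∂μ, 0 ≤ z ⬝ᵥ X x) : ∀ᵐ x ∂μ, z ⬝ᵥ X x = 0 := by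
  have hintg : ∀ i, Integrable (fun x => z i * (w x * rho (y ⬝ᵥ X x) * X x i)) μ := fun i => by
    refine Integrable.const_mul ?_ _
    refine Integrable.of_bound (C := 2) ((hw.mul (continuous_rho.measurable.comp
      (measurable_const_dotProduct hX y))).mul
      ((measurable_pi_apply i).comp hX)).aestronglyMeasurable (Eventually.of_forall fun x => ?_)
    rw [Real.norm_eq_abs, abs_mul, abs_mul, abs_of_pos (hw0 x), abs_of_pos (rho_pos _)]
    have h3 := mul_nonneg (hw0 x).le (abs_nonneg (X x i))
    calc w x * rho (y ⬝ᵥ X x) * |X x i| = rho (y ⬝ᵥ X x) * (w x * |X x i|) := by ring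
      _ ≤ 2 * 1 := mul_le_mul (rho_le_two _) (hwX x i) h3 zero_le_two
      _ = 2 := by norm_num
  have heq : ∀ x, w x * rho (y ⬝ᵥ X x) * (z ⬝ᵥ X x) =
      ∑ i, z i * (w x * rho (y ⬝ᵥ X x) * X x i) := fun x => by
    change w x * rho (y ⬝ᵥ X x) * ∑ i, z i * X x i = _
    rw [Finset.mul_sum]
    exact Finset.sum_congr rfl fun i _ => by ring
  have h0 : ∫ x, w x * rho (y ⬝ᵥ X x) * (z ⬝ᵥ X x) ∂μ = 0 := by
    simp_rw [heq]
    rw [integral_finsetSum _ fun i _ => hintg i]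
    exact Finset.sum_eq_zero fun i _ => by rw [integral_const_mul, hy i, mul_zero]
  have hi : Integrable (fun x => w x * rho (y ⬝ᵥ X x) * (z ⬝ᵥ X x)) μ := by
    simp_rw [heq]
    exact integrable_finsetSum _ fun i _ => hintg i
  have hpos : ∀ x, 0 < w x * rho (y ⬝ᵥ X x) := fun x => mul_pos (hw0 x) (rho_pos _)
  have hnn : 0 ≤ᵐ[μ] fun x => w x * rho (y ⬝ᵥ X x) * (z ⬝ᵥ X x) := by
    filter_upwards [hz] with x hx
    exact mul_nonneg (hpos x).le hx
  filter_upwards [(integral_eq_zero_iff_of_nonneg_ae hnn hi).1 h0] with x hx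
  exact (mul_eq_zero.1 hx).resolve_left (hpos x).ne'

end Rogers

/-! ### Parametrizations of analytic correspondences and measurable selection -/

section Parametrization

variable {A : Type*} [MeasurableSpace A] [TopologicalSpace A] [PolishSpace A] [BorelSpace A]
  {E : Type*} [MeasurableSpace E] [TopologicalSpace E] [PolishSpace E] [BorelSpace E]

/-- A continuous parametrization of the graph of a correspondence by the Baire space. -/
structure GraphParam (Γ : A → Set (ProbabilityMeasure E)) where
  /-- The base point. -/
  pt : (ℕ → ℕ) → A
  /-- The measure. -/
  meas : (ℕ → ℕ) → ProbabilityMeasure E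
  continuous_pt : Continuous pt
  continuous_meas : Continuous meas
  mem_iff : ∀ ω P, P ∈ Γ ω ↔ ∃ z, pt z = ω ∧ meas z = P

theorem nonempty_graphParam [Nonempty A] {Γ : A → Set (ProbabilityMeasure E)}
    (hne : ∀ ω, (Γ ω).Nonempty)
    (hΓ : AnalyticSet {p : A × ProbabilityMeasure E | p.2 ∈ Γ p.1}) : Nonempty (GraphParam Γ) := by
  rw [AnalyticSet] at hΓ
  rcases hΓ with h | ⟨f, hf, hr⟩
  · obtain ⟨ω⟩ := ‹Nonempty A›
    obtain ⟨P, hP⟩ := hne ω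
    have : (ω, P) ∈ {p : A × ProbabilityMeasure E | p.2 ∈ Γ p.1} := hP
    rw [h] at this
    exact this.elim
  · refine ⟨⟨fun z => (f z).1, fun z => (f z).2, hf.fst, hf.snd, fun ω P => ?_⟩⟩
    have : P ∈ Γ ω ↔ (ω, P) ∈ range f := by rw [hr]; rfl
    rw [this]
    simp only [mem_range, Prod.ext_iff]

namespace GraphParam

variable {Γ : A → Set (ProbabilityMeasure E)} (G : GraphParam Γ)

theorem meas_mem (z : ℕ → ℕ) : G.meas z ∈ Γ (G.pt z) := (G.mem_iff _ _).2 ⟨z, rfl, rfl⟩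

/-- The parametrization as a Markov kernel. -/
def kernel : Kernel (ℕ → ℕ) E where
  toFun z := (G.meas z : Measure E)
  measurable' := by
    let _ : MeasurableSpace (ProbabilityMeasure E) := borel _
    have _ : BorelSpace (ProbabilityMeasure E) := ⟨rfl⟩
    exact measurable_toMeasure_borel.comp G.continuous_meas.measurable

theorem kernel_apply (z : ℕ → ℕ) : G.kernel z = (G.meas z : Measure E) := rfl

instance : IsMarkovKernel G.kernel := ⟨fun z => by rw [kernel_apply]; infer_instance⟩

/-- Selection of measures subject to a Borel constraint on the parameters. -/
theorem exists_selector (hne : ∀ ω, (Γ ω).Nonempty) {W : Type*} [MeasurableSpace W]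
    [TopologicalSpace W] [PolishSpace W] [BorelSpace W] [Nonempty W]
    {B : Set ((ℕ → ℕ) × W)} (hB : MeasurableSet B) :
    ∃ κ : A → ProbabilityMeasure E, Measurable[univComp A, borel (ProbabilityMeasure E)] κ ∧
      (∀ ω, κ ω ∈ Γ ω) ∧ ∀ z w, (z, w) ∈ B →
        ∃ z' w', G.pt z' = G.pt z ∧ G.meas z' = κ (G.pt z) ∧ (z', w') ∈ B := by
  classical
  let _ : MeasurableSpace (ProbabilityMeasure E) := borel _
  have _ : BorelSpace (ProbabilityMeasure E) := ⟨rfl⟩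
  have hg : Measurable fun p : (ℕ → ℕ) × W => G.pt p.1 :=
    G.continuous_pt.measurable.comp measurable_fst
  obtain ⟨himg, σ, hσ, hσB⟩ := exists_univComp_selector hg hB
  obtain ⟨-, τ, hτ, hτB⟩ := exists_univComp_selector hg MeasurableSet.univ
  have hsurj : ∀ ω, ω ∈ (fun p : (ℕ → ℕ) × W => G.pt p.1) '' univ := fun ω => by
    obtain ⟨P, hP⟩ := hne ω
    obtain ⟨z, hz, -⟩ := (G.mem_iff ω P).1 hP
    exact ⟨(z, Classical.arbitrary W), mem_univ _, hz⟩
  let D := (fun p : (ℕ → ℕ) × W => G.pt p.1) '' B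
  let s : A → (ℕ → ℕ) × W := D.piecewise σ τ
  have hs : Measurable[univComp A] s := Measurable.piecewise himg hσ hτ
  have hspt : ∀ ω, G.pt (s ω).1 = ω := fun ω => by
    by_cases hω : ω ∈ D
    · simp only [s, piecewise_eq_of_mem _ _ _ hω]
      exact (hσB ω hω).2
    · simp only [s, piecewise_eq_of_notMem _ _ _ hω]
      exact (hτB ω (hsurj ω)).2
  refine ⟨fun ω => G.meas (s ω).1, ?_, fun ω => ?_, fun z w hzw => ?_⟩
  · exact G.continuous_meas.measurable.comp (measurable_fst.comp hs)
  · exact (G.mem_iff _ _).2 ⟨(s ω).1, hspt ω, rfl⟩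
  · have hD : G.pt z ∈ D := ⟨(z, w), hzw, rfl⟩
    refine ⟨(s (G.pt z)).1, (s (G.pt z)).2, hspt _, rfl, ?_⟩
    simp only [s, piecewise_eq_of_mem _ _ _ hD]
    exact (hσB _ hD).1

end GraphParam

end Parametrization

/-! ### Measurability of nearest points -/

section NearestPoint

variable {d : ℕ}

/-- The squared Euclidean distance on `ℝ^d`. -/
def sqDist (q y : Fin d → ℝ) : ℝ := ∑ i, (q i - y i) ^ 2

theorem continuous_sqDist : Continuous fun p : (Fin d → ℝ) × (Fin d → ℝ) => sqDist p.1 p.2 := by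
  unfold sqDist; fun_prop

theorem norm_sub_sq_le_sqDist (q y : Fin d → ℝ) : ‖y - q‖ ^ 2 ≤ sqDist q y := by
  have hnn : 0 ≤ sqDist q y := Finset.sum_nonneg fun i _ => sq_nonneg _
  have : ‖y - q‖ ≤ √(sqDist q y) := by
    refine (pi_norm_le_iff_of_nonneg (Real.sqrt_nonneg _)).2 fun i => ?_
    refine Real.le_sqrt_of_sq_le ?_
    rw [Real.norm_eq_abs, sq_abs, Pi.sub_apply, ← neg_sub, neg_sq]
    exact Finset.single_le_sum (f := fun i => (q i - y i) ^ 2) (fun i _ => sq_nonneg _)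
      (Finset.mem_univ i)
  calc ‖y - q‖ ^ 2 ≤ √(sqDist q y) ^ 2 := by gcongr
    _ = _ := Real.sq_sqrt hnn

theorem isCompact_sqDist_le (q : Fin d → ℝ) (r : ℝ) : IsCompact {y | sqDist q y ≤ r} := by
  refine Metric.isCompact_of_isClosed_isBounded ?_ ?_
  · exact isClosed_le (continuous_sqDist.comp (continuous_const.prodMk continuous_id))
      continuous_const
  · refine (Metric.isBounded_closedBall (x := q) (r := √r)).subset fun y hy => ?_
    rw [Metric.mem_closedBall, dist_eq_norm]
    exact Real.le_sqrt_of_sq_le ((norm_sub_sq_le_sqDist q y).trans hy)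

theorem exists_sqDist_min (q : Fin d → ℝ) {C : Set (Fin d → ℝ)} (hC : IsClosed C)
    (hne : C.Nonempty) : ∃ y ∈ C, ∀ z ∈ C, sqDist q y ≤ sqDist q z := by
  obtain ⟨y₀, hy₀⟩ := hne
  obtain ⟨y, hy, hmin⟩ := ((isCompact_sqDist_le q (sqDist q y₀)).inter_left hC).exists_isMinOn
    ⟨y₀, hy₀, le_refl (sqDist q y₀)⟩
    (continuous_sqDist.comp (continuous_const.prodMk continuous_id)).continuousOn
  refine ⟨y, hy.1, fun z hz => ?_⟩
  by_cases h : sqDist q z ≤ sqDist q y₀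
  · exact hmin ⟨hz, h⟩
  · have h1 : sqDist q y ≤ sqDist q y₀ := hy.2
    linarith

theorem eq_of_sqDist_min (q : Fin d → ℝ) {C : Set (Fin d → ℝ)} (hC : Convex ℝ C)
    {y z : Fin d → ℝ} (hy : y ∈ C) (hz : z ∈ C) (hmin : ∀ v ∈ C, sqDist q y ≤ sqDist q v)
    (hzy : sqDist q z ≤ sqDist q y) : z = y := by
  have hmid : (1 / 2 : ℝ) • y + (1 / 2 : ℝ) • z ∈ C :=
    hC hy hz (by norm_num) (by norm_num) (by norm_num)
  have h1 := hmin _ hmid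
  have h2 : sqDist q ((1 / 2 : ℝ) • y + (1 / 2 : ℝ) • z) =
      (sqDist q y + sqDist q z) / 2 - sqDist y z / 4 := by
    simp only [sqDist]
    rw [← Finset.sum_add_distrib, Finset.sum_div, Finset.sum_div, ← Finset.sum_sub_distrib]
    refine Finset.sum_congr rfl fun i _ => ?_
    simp only [Pi.add_apply, Pi.smul_apply, smul_eq_mul]
    ring
  have h3 := norm_sub_sq_le_sqDist y z
  have h4 : ‖z - y‖ ^ 2 ≤ 0 := by linarith
  have h5 : ‖z - y‖ = 0 := by nlinarith [norm_nonneg (z - y)]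
  exact sub_eq_zero.1 (norm_eq_zero.1 h5)

/-- If the hitting sets of compacts by a closed convex valued correspondence are measurable, then
so is the nearest point map. -/
theorem measurable_of_sqDist_min {A : Type*} {m : MeasurableSpace A} {C : A → Set (Fin d → ℝ)}
    (hcl : ∀ ω, IsClosed (C ω)) (hcv : ∀ ω, Convex ℝ (C ω))
    (hm : ∀ K : Set (Fin d → ℝ), IsCompact K → MeasurableSet {ω | C ω ∩ K = ∅})
    (q : Fin d → ℝ) {p : A → Fin d → ℝ} (hp : ∀ ω, p ω ∈ C ω)
    (hmin : ∀ ω, ∀ v ∈ C ω, sqDist q (p ω) ≤ sqDist q v) : Measurable p := by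
  refine measurable_of_isClosed fun K hK => ?_
  have heq : p ⁻¹' K = ⋂ r : ℚ, ({ω | C ω ∩ (K ∩ {y | sqDist q y ≤ r}) = ∅}ᶜ ∪
      {ω | C ω ∩ {y | sqDist q y ≤ r} = ∅}) := by
    ext ω
    simp only [mem_preimage, mem_iInter, mem_union, mem_compl_iff, mem_ofPred_eq]
    constructor
    · intro hω r
      by_cases h : C ω ∩ {y | sqDist q y ≤ r} = ∅
      · exact Or.inr h
      · left
        obtain ⟨v, hv, hvr⟩ := nonempty_iff_ne_empty.2 h
        exact (nonempty_iff_ne_empty.1 ⟨p ω, hp ω, hω, (hmin ω v hv).trans hvr⟩)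
    · intro h
      have hr : ∀ r : ℚ, sqDist q (p ω) < r → ∃ v ∈ C ω ∩ K, sqDist q v ≤ r := by
        intro r hr
        rcases h r with h1 | h1
        · obtain ⟨v, hv, hvK, hvr⟩ := nonempty_iff_ne_empty.2 h1
          exact ⟨v, ⟨hv, hvK⟩, hvr⟩
        · exact absurd h1 (nonempty_iff_ne_empty.1 ⟨p ω, hp ω, hr.le⟩)
      obtain ⟨r₀, hr₀⟩ := exists_rat_gt (sqDist q (p ω))
      obtain ⟨v₀, hv₀, -⟩ := hr r₀ hr₀
      obtain ⟨y, hy, hymin⟩ := exists_sqDist_min q ((hcl ω).inter hK) ⟨v₀, hv₀⟩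
      have hle : sqDist q y ≤ sqDist q (p ω) := by
        by_contra hlt
        push Not at hlt
        obtain ⟨r, h1, h2⟩ := exists_rat_btwn hlt
        obtain ⟨v, hv, hvr⟩ := hr r h1
        linarith [hymin v hv]
      rw [← eq_of_sqDist_min q (hcv ω) (hp ω) hy.1 (hmin ω) hle]
      exact hy.2
  rw [heq]
  exact MeasurableSet.iInter fun r => ((hm _ ((isCompact_sqDist_le q r).inter_left hK)).compl).union
    (hm _ (isCompact_sqDist_le q r))

end NearestPoint

/-! ### Measurable one-period arbitrage -/

section Weight

variable {d : ℕ}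

/-- A weight making a vector bounded. -/
def baseWeight (v : Fin d → ℝ) : ℝ := (1 + ∑ i, |v i|)⁻¹

theorem one_le_one_add_sum_abs (v : Fin d → ℝ) : 1 ≤ 1 + ∑ i, |v i| :=
  le_add_of_nonneg_right (Finset.sum_nonneg fun _ _ => abs_nonneg _)

theorem baseWeight_pos (v : Fin d → ℝ) : 0 < baseWeight v :=
  inv_pos.2 (one_pos.trans_le (one_le_one_add_sum_abs v))

theorem baseWeight_le_one (v : Fin d → ℝ) : baseWeight v ≤ 1 :=
  inv_le_one_of_one_le₀ (one_le_one_add_sum_abs v)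

theorem baseWeight_mul_abs_le (v : Fin d → ℝ) (i : Fin d) : baseWeight v * |v i| ≤ 1 := by
  rw [baseWeight, inv_mul_le_iff₀ (one_pos.trans_le (one_le_one_add_sum_abs v)), mul_one]
  have := Finset.single_le_sum (f := fun i => |v i|) (fun i _ => abs_nonneg _) (Finset.mem_univ i)
  linarith

theorem measurable_baseWeight : Measurable (baseWeight (d := d)) := by
  unfold baseWeight; fun_prop

end Weight

section MeasurableArbitrage

variable {A : Type*} [MeasurableSpace A] [TopologicalSpace A] [PolishSpace A] [BorelSpace A]
  {E : Type*} [MeasurableSpace E] [TopologicalSpace E] [PolishSpace E] [BorelSpace E] {d : ℕ}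
  {Γ : A → Set (ProbabilityMeasure E)} {X : A → E → Fin d → ℝ}

/-- The portfolios without losses. -/
def noLoss (Γ : A → Set (ProbabilityMeasure E)) (X : A → E → Fin d → ℝ) (ω : A) :
    Set (Fin d → ℝ) :=
  {y | ∀ P ∈ Γ ω, ∀ᵐ x ∂(P : Measure E), 0 ≤ y ⬝ᵥ X ω x}

theorem isClosed_noLoss (ω : A) : IsClosed (noLoss Γ X ω) := by
  have : noLoss Γ X ω = ⋂ P ∈ Γ ω, {y | ∀ᵐ x ∂(P : Measure E), 0 ≤ y ⬝ᵥ X ω x} := by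
    ext y; simp [noLoss]
  rw [this]
  exact isClosed_biInter fun P _ => isClosed_setOf_ae_nonneg _

theorem convex_noLoss (ω : A) : Convex ℝ (noLoss Γ X ω) := by
  intro y hy z hz a b ha hb _ P hP
  filter_upwards [hy P hP, hz P hP] with x h1 h2
  rw [add_dotProduct, smul_dotProduct, smul_dotProduct, smul_eq_mul, smul_eq_mul]
  exact add_nonneg (mul_nonneg ha h1) (mul_nonneg hb h2)

theorem zero_mem_noLoss (ω : A) : 0 ∈ noLoss Γ X ω := fun P _ =>
  Eventually.of_forall fun x => by rw [zero_dotProduct]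

theorem measurable_dotProduct : Measurable fun p : (Fin d → ℝ) × (Fin d → ℝ) => p.1 ⬝ᵥ p.2 :=
  Finset.measurable_sum _ fun i _ => ((measurable_pi_apply i).comp measurable_fst).mul
    ((measurable_pi_apply i).comp measurable_snd)

theorem measurableSet_noLoss_inter_eq_empty (G : GraphParam Γ) (hne : ∀ ω, (Γ ω).Nonempty)
    (hΓ : ∀ ω, ConvexPM (Γ ω)) (hX : Measurable fun p : A × E => X p.1 p.2)
    {K : Set (Fin d → ℝ)} (hK : IsCompact K) :
    MeasurableSet[univComp A] {ω | noLoss Γ X ω ∩ K = ∅} := by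
  have hXω : ∀ ω, Measurable (X ω) := fun ω => hX.comp measurable_prodMk_left
  let a : (ℕ → ℕ) → (Fin d → ℝ) → ℝ := fun z y =>
    ∫ x, baseWeight (X (G.pt z) x) * max (-(y ⬝ᵥ X (G.pt z) x)) 0 ∂(G.kernel z)
  have hapos : ∀ z y, 0 < a z y ↔ ¬ ∀ᵐ x ∂(G.kernel z), 0 ≤ y ⬝ᵥ X (G.pt z) x := fun z y =>
    integral_weight_loss_pos_iff (hXω _) (measurable_baseWeight.comp (hXω _))
      (fun _ => baseWeight_pos _) (fun _ => baseWeight_le_one _)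
      (fun _ i => baseWeight_mul_abs_le _ i) y
  have hac : ∀ z, Continuous (a z) := fun z =>
    continuous_integral_weight_comp (hXω _) (measurable_baseWeight.comp (hXω _))
      (fun _ => baseWeight_pos _) (fun _ => baseWeight_le_one _)
      (fun _ i => baseWeight_mul_abs_le _ i) continuous_max_neg abs_max_neg_sub_le
  have ham : ∀ y, Measurable fun z => a z y := fun y => by
    have hXz : Measurable fun p : (ℕ → ℕ) × E => X (G.pt p.1) p.2 :=
      hX.comp ((G.continuous_pt.measurable.comp measurable_fst).prodMk measurable_snd)
    have hm : Measurable fun p : (ℕ → ℕ) × E =>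
        baseWeight (X (G.pt p.1) p.2) * max (-(y ⬝ᵥ X (G.pt p.1) p.2)) 0 :=
      (measurable_baseWeight.comp hXz).mul (continuous_max_neg.measurable.comp
        (measurable_dotProduct.comp (measurable_const.prodMk hXz)))
    exact (hm.stronglyMeasurable.integral_kernel_prod_right' (κ := G.kernel)).measurable
  obtain ⟨D, hDc, hDd⟩ := TopologicalSpace.exists_countable_dense K
  let B : Set (ℕ → ℕ) := ⋃ n : ℕ, ⋂ y ∈ D, {z | 1 / ((n : ℝ) + 1) ≤ a z y}
  have hB : MeasurableSet B := MeasurableSet.iUnion fun n => MeasurableSet.biInter hDc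
    fun y _ => (ham y) measurableSet_Ici
  have hBK : ∀ z, z ∈ B ↔ ∀ y ∈ K, ¬ ∀ᵐ x ∂(G.kernel z), 0 ≤ y ⬝ᵥ X (G.pt z) x := by
    intro z
    simp only [B, mem_iUnion, mem_iInter]
    constructor
    · rintro ⟨n, hn⟩ y hy
      rw [← hapos]
      have hcl : IsClosed {v : K | 1 / ((n : ℝ) + 1) ≤ a z v} :=
        isClosed_le continuous_const ((hac z).comp continuous_subtype_val)
      have : (⟨y, hy⟩ : K) ∈ {v : K | 1 / ((n : ℝ) + 1) ≤ a z v} :=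
        hcl.closure_subset_iff.2 (fun v hv => hn v hv) (hDd ⟨y, hy⟩)
      exact (Nat.one_div_pos_of_nat).trans_le this
    · intro h
      rcases K.eq_empty_or_nonempty with rfl | hKne
      · exact ⟨0, fun y _ => y.2.elim⟩
      · obtain ⟨y, hy, hmin⟩ := hK.exists_isMinOn hKne (hac z).continuousOn
        obtain ⟨n, hn⟩ := exists_nat_one_div_lt ((hapos z y).2 (h y hy))
        exact ⟨n, fun v _ => hn.le.trans (hmin v.2)⟩
  have heq : {ω | noLoss Γ X ω ∩ K = ∅} = G.pt '' B := by
    ext ω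
    constructor
    · intro hω
      obtain ⟨P₀, hP₀⟩ := hne ω
      obtain ⟨R, hR, -, hRK⟩ := exists_mem_forall_compact (X := X ω) (hΓ ω) hP₀ hK (fun y hy => by
        by_contra hcon
        push Not at hcon
        have : y ∈ noLoss Γ X ω ∩ K := ⟨hcon, hy⟩
        rw [show noLoss Γ X ω ∩ K = ∅ from hω] at this
        exact this)
      obtain ⟨z, rfl, rfl⟩ := (G.mem_iff ω R).1 hR
      exact ⟨z, (hBK z).2 hRK, rfl⟩
    · rintro ⟨z, hz, rfl⟩
      refine eq_empty_iff_forall_notMem.2 fun y hy => ?_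
      exact (hBK z).1 hz y hy.2 (hy.1 _ (G.meas_mem z))
  rw [heq]
  exact (exists_univComp_selector G.continuous_pt.measurable hB).1

theorem exists_measurable_arbitrage (G : GraphParam Γ) (hne : ∀ ω, (Γ ω).Nonempty)
    (hΓ : ∀ ω, ConvexPM (Γ ω)) (hX : Measurable fun p : A × E => X p.1 p.2) :
    ∃ p : ℕ → A → Fin d → ℝ, (∀ n, Measurable[univComp A] (p n)) ∧
      (∀ n ω, ∀ P ∈ Γ ω, ∀ᵐ x ∂(P : Measure E), 0 ≤ p n ω ⬝ᵥ X ω x) ∧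
      (∀ n, MeasurableSet[univComp A]
        {ω | ∃ P ∈ Γ ω, ¬ ∀ᵐ x ∂(P : Measure E), p n ω ⬝ᵥ X ω x = 0}) ∧
      ∀ ω, (¬ NA1 ((fun P : ProbabilityMeasure E => (P : Measure E)) '' Γ ω) (X ω)) ↔
        ∃ n, ∃ P ∈ Γ ω, ¬ ∀ᵐ x ∂(P : Measure E), p n ω ⬝ᵥ X ω x = 0 := by
  have hXω : ∀ ω, Measurable (X ω) := fun ω => hX.comp measurable_prodMk_left
  let q : ℕ → Fin d → ℝ := TopologicalSpace.denseSeq (Fin d → ℝ)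
  have hex : ∀ n ω, ∃ y ∈ noLoss Γ X ω, ∀ v ∈ noLoss Γ X ω, sqDist (q n) y ≤ sqDist (q n) v :=
    fun n ω => exists_sqDist_min (q n) (isClosed_noLoss ω) ⟨0, zero_mem_noLoss ω⟩
  choose p hpC hpmin using hex
  have hpm : ∀ n, Measurable[univComp A] (p n) := fun n =>
    measurable_of_sqDist_min isClosed_noLoss convex_noLoss
      (fun K hK => measurableSet_noLoss_inter_eq_empty G hne hΓ hX hK) (q n) (hpC n) (hpmin n)
  refine ⟨p, hpm, hpC, fun n => ?_, fun ω => ?_⟩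
  · let B : Set ((ℕ → ℕ) × (Fin d → ℝ)) :=
      {b | ¬ ∀ᵐ x ∂(G.kernel b.1), b.2 ⬝ᵥ X (G.pt b.1) x = 0}
    have hB : MeasurableSet B := by
      have hs : MeasurableSet {c : ((ℕ → ℕ) × (Fin d → ℝ)) × E |
          ¬ c.1.2 ⬝ᵥ X (G.pt c.1.1) c.2 = 0} := by
        have hm : Measurable fun c : ((ℕ → ℕ) × (Fin d → ℝ)) × E =>
            c.1.2 ⬝ᵥ X (G.pt c.1.1) c.2 :=
          measurable_dotProduct.comp (measurable_fst.snd.prodMk (hX.comp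
            ((G.continuous_pt.measurable.comp measurable_fst.fst).prodMk measurable_snd)))
        exact hm (measurableSet_singleton 0).compl
      have := Kernel.measurable_kernel_prodMk_left
        (κ := G.kernel.comap (Prod.fst : (ℕ → ℕ) × (Fin d → ℝ) → _) measurable_fst) hs
      exact this (measurableSet_singleton 0).compl
    have hg : Measurable fun b : (ℕ → ℕ) × (Fin d → ℝ) => (G.pt b.1, b.2) :=
      (G.continuous_pt.measurable.comp measurable_fst).prodMk measurable_snd
    have himg := (exists_univComp_selector hg hB).1
    have hid : Measurable[univComp A, univComp (A × (Fin d → ℝ))] fun ω => (ω, p n ω) :=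
      measurable_univComp_univComp
        (Measurable.prodMk (Measurable.mono measurable_id le_univComp le_rfl) (hpm n))
    convert hid himg using 1
    ext ω
    simp only [mem_ofPred_eq, mem_preimage, mem_image, Prod.mk.injEq, Prod.exists]
    constructor
    · rintro ⟨P, hP, h⟩
      obtain ⟨z, rfl, rfl⟩ := (G.mem_iff ω P).1 hP
      exact ⟨z, p n (G.pt z), h, rfl, rfl⟩
    · rintro ⟨z, y, h, rfl, rfl⟩
      exact ⟨G.meas z, G.meas_mem z, h⟩
  · rw [na1_iff (hXω ω)]
    simp only [forall_mem_image]
    constructor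
    · intro h
      simp only [not_forall] at h
      obtain ⟨y, hy, P, hP, hyP⟩ := h
      let N := nullPortfolios ((fun P : ProbabilityMeasure E => (P : Measure E)) '' Γ ω) (X ω)
      have hyN : y ∉ N := fun hyN => hyP (hyN _ ⟨P, hP, rfl⟩)
      have hNo : IsOpen (N : Set (Fin d → ℝ))ᶜ := N.closed_of_finiteDimensional.isOpen_compl
      obtain ⟨ε, hε, hεN⟩ := Metric.isOpen_iff.1 hNo y hyN
      let U : Set (Fin d → ℝ) := {v | sqDist v y < (ε / 2) ^ 2} ∩ Metric.ball y (ε / 2)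
      have hU : IsOpen U := (isOpen_lt (continuous_sqDist.comp
        (continuous_id.prodMk continuous_const)) continuous_const).inter Metric.isOpen_ball
      have hyU : y ∈ U := by
        refine ⟨?_, Metric.mem_ball_self (half_pos hε)⟩
        change sqDist y y < _
        simp only [sqDist, sub_self]
        simp only [ne_eq, OfNat.ofNat_ne_zero, not_false_eq_true, zero_pow, Finset.sum_const_zero]
        positivity
      obtain ⟨n, hv1, hv2⟩ :=
        (TopologicalSpace.denseRange_denseSeq (Fin d → ℝ)).exists_mem_open hU ⟨y, hyU⟩
      have h1 : ‖p n ω - q n‖ < ε / 2 := by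
        refine lt_of_pow_lt_pow_left₀ 2 (half_pos hε).le ?_
        exact (norm_sub_sq_le_sqDist _ _).trans_lt ((hpmin n ω y hy).trans_lt hv1)
      have h2 : p n ω ∈ Metric.ball y ε := by
        rw [Metric.mem_ball, dist_eq_norm]
        have h3 : ‖q n - y‖ < ε / 2 := by rw [← dist_eq_norm]; exact hv2
        calc ‖p n ω - y‖ = ‖(p n ω - q n) + (q n - y)‖ := by congr 1; abel
          _ ≤ _ := norm_add_le _ _
          _ < ε := by linarith
      have h3 : p n ω ∉ N := hεN h2
      refine ⟨n, ?_⟩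
      by_contra hcon
      simp only [not_exists, not_and, not_not] at hcon
      refine h3 ?_
      rintro _ ⟨P', hP', rfl⟩
      exact hcon P' hP'
    · rintro ⟨n, P, hP, h⟩ hall
      exact h (hall (p n ω) (fun P' hP' => hpC n ω P' hP') hP)

end MeasurableArbitrage

/-! ### Absence of arbitrage is local -/

section Local

variable {Ω₁ : Type} [MeasurableSpace Ω₁] {T d : ℕ} {S : (t : ℕ) → (Fin t → Ω₁) → Fin d → ℝ}

theorem measurable_incr (hS : ∀ t, t ≤ T → Measurable (S t)) {t : ℕ} (ht : t < T) :
    Measurable fun p : (Fin t → Ω₁) × Ω₁ => incr Ω₁ S t p.1 p.2 :=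
  measurable_pi_lambda _ fun i =>
    ((measurable_pi_apply i).comp ((hS (t + 1) ht).comp measurable_snocPath)).sub
      ((measurable_pi_apply i).comp ((hS t ht.le).comp measurable_fst))

theorem incr_restr {t : ℕ} (ht : t < T) (ω : Fin T → Ω₁) (i : Fin d) :
    incr Ω₁ S t (restr Ω₁ t ht.le ω) (ω ⟨t, ht⟩) i =
      S (t + 1) (restr Ω₁ (t + 1) ht ω) i - S t (restr Ω₁ t ht.le ω) i := by
  have h : snocPath (restr Ω₁ t ht.le ω, ω ⟨t, ht⟩) = restr Ω₁ (t + 1) ht ω :=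
    snocPath_restr (restr Ω₁ (t + 1) ht ω)
  rw [← h]
  rfl

theorem gain_update {t : ℕ} (ht : t < T) (p : (Fin t → Ω₁) → Fin d → ℝ) (ω : Fin T → Ω₁) :
    gain Ω₁ S (Function.update (fun _ _ => 0) t p) T le_rfl ω =
      p (restr Ω₁ t ht.le ω) ⬝ᵥ incr Ω₁ S t (restr Ω₁ t ht.le ω) (ω ⟨t, ht⟩) := by
  rw [gain, Finset.sum_eq_single_of_mem ⟨t, ht⟩ (Finset.mem_univ _)]
  · simp only [Function.update_self, dotProduct, incr_restr ht]
  · intro u _ hu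
    have : (u : ℕ) ≠ t := fun h => hu (Fin.ext h)
    simp [Function.update_of_ne this]

variable [TopologicalSpace Ω₁] [PolishSpace Ω₁] [BorelSpace Ω₁]
  {Pt : (t : ℕ) → (Fin t → Ω₁) → Set (ProbabilityMeasure Ω₁)}

/-- The path up to time `t` together with the next coordinate. -/
def splitAt {t : ℕ} (ht : t < T) (ω : Fin T → Ω₁) : (Fin t → Ω₁) × Ω₁ :=
  (restr Ω₁ t ht.le ω, ω ⟨t, ht⟩)

theorem measurable_splitAt {t : ℕ} (ht : t < T) : Measurable (splitAt (Ω₁ := Ω₁) ht) :=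
  (measurable_restr _ _).prodMk (measurable_pi_apply _)

theorem map_splitAt {t : ℕ} (ht : t < T) {P : Measure (Fin T → Ω₁)}
    {μ : Measure ((Fin t → Ω₁) × Ω₁)} (h : P.map (restr Ω₁ (t + 1) ht) = μ.map snocPath) :
    P.map (splitAt ht) = μ := by
  have h1 : splitAt (Ω₁ := Ω₁) ht = splitAt t.lt_succ_self ∘ restr Ω₁ (t + 1) ht := rfl
  have h2 : splitAt (Ω₁ := Ω₁) t.lt_succ_self ∘ snocPath = id := by
    funext p
    refine Prod.ext (restr_snocPath p) ?_
    exact Fin.snoc_last (α := fun _ => Ω₁) _ _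
  rw [h1, ← Measure.map_map (measurable_splitAt _) (measurable_restr _ _), h,
    Measure.map_map (measurable_splitAt _) measurable_snocPath, h2, Measure.map_id]

theorem ae_compProd_fst {t : ℕ} {ν : Measure (Fin t → Ω₁)} [SFinite ν] {η : Kernel (Fin t → Ω₁) Ω₁}
    [IsMarkovKernel η] {q : (Fin t → Ω₁) → Prop} (h : ∀ᵐ ω ∂ν, q ω) :
    ∀ᵐ c ∂(ν ⊗ₘ η), q c.1 := by
  rw [← Measure.fst_compProd ν η] at h
  exact ae_of_ae_map measurable_fst.aemeasurable h

theorem exists_measurable_selector [Nonempty Ω₁] {t : ℕ} (hne : ∀ ω, (Pt t ω).Nonempty)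
    (hgraph : AnalyticSet {p : (Fin t → Ω₁) × ProbabilityMeasure Ω₁ | p.2 ∈ Pt t p.1}) :
    ∃ κ : (Fin t → Ω₁) → ProbabilityMeasure Ω₁,
      Measurable[univComp (Fin t → Ω₁), borel (ProbabilityMeasure Ω₁)] κ ∧ ∀ ω, κ ω ∈ Pt t ω := by
  obtain ⟨G⟩ := nonempty_graphParam hne hgraph
  obtain ⟨κ, h1, h2, -⟩ := G.exists_selector (W := ℝ) hne MeasurableSet.univ
  exact ⟨κ, h1, h2⟩

theorem null_setOf_arbitrage (hS : ∀ t, t ≤ T → Measurable (S t))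
    (hsel : ∀ t < T, ∃ κ : (Fin t → Ω₁) → ProbabilityMeasure Ω₁,
      Measurable[univComp (Fin t → Ω₁), borel (ProbabilityMeasure Ω₁)] κ ∧ ∀ ω, κ ω ∈ Pt t ω)
    (hNA : NA Ω₁ (MeasFam Ω₁ Pt T) S (fun i : Fin 0 => i.elim0)) {t : ℕ} (ht : t < T)
    (hne : ∀ ω, (Pt t ω).Nonempty) (G : GraphParam (Pt t)) {p : (Fin t → Ω₁) → Fin d → ℝ}
    (hp : Measurable[univComp (Fin t → Ω₁)] p)
    (hpos : ∀ ω, ∀ P ∈ Pt t ω, ∀ᵐ x ∂(P : Measure Ω₁), 0 ≤ p ω ⬝ᵥ incr Ω₁ S t ω x)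
    {ν : Measure (Fin t → Ω₁)} (hν : ν ∈ MeasFam Ω₁ Pt t) :
    ν {ω | ∃ P ∈ Pt t ω, ¬ ∀ᵐ x ∂(P : Measure Ω₁), p ω ⬝ᵥ incr Ω₁ S t ω x = 0} = 0 := by
  have hX := measurable_incr hS ht
  let H : (u : ℕ) → (Fin u → Ω₁) → Fin d → ℝ := Function.update (fun _ _ => 0) t p
  have hH : Pred Ω₁ d H := fun u => by
    by_cases hu : u = t
    · subst hu
      simpa [H] using hp
    · simp only [H, Function.update_of_ne hu]
      exact measurable_const
  have hgm : Measurable[univComp (Fin T → Ω₁)] (gain Ω₁ S H T le_rfl) :=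
    measurable_univComp_gain hS hH le_rfl
  have hver : ∀ ν' ∈ MeasFam Ω₁ Pt t, ∃ p' : (Fin t → Ω₁) → Fin d → ℝ, Measurable p' ∧
      p =ᵐ[ν'] p' := fun ν' hν' => by
    have := isProbabilityMeasure_of_mem_measFam hν'
    have h := aemeasurable_of_univComp hp ν'
    exact ⟨h.mk, h.measurable_mk, h.ae_eq_mk⟩
  have hpos' : QuasiSure (MeasFam Ω₁ Pt T) (univComp (Fin T → Ω₁))
      (fun ω => 0 ≤ gain Ω₁ S H T le_rfl ω +
        ∑ i : Fin 0, (0 : Fin 0 → ℝ) i *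
          (fun i : Fin 0 => i.elim0 : Fin 0 → (Fin T → Ω₁) → ℝ) i ω) := by
    simp only [Finset.univ_eq_empty, Finset.sum_empty, add_zero]
    refine ⟨_, (hgm measurableSet_Ici).compl, subset_rfl, fun P hP => ?_⟩
    have hP' := map_restr_mem_measFam ht hP
    obtain ⟨ν', hν', κ, hκ, hκP, h⟩ := exists_kernel_of_mem_measFam_succ hP'
    have := isProbabilityMeasure_of_mem_measFam hν'
    obtain ⟨η, _, hη⟩ := exists_kernel_ae_eq ν' hκ
    have hPη := h η inferInstance hη
    obtain ⟨p', hp', hpp'⟩ := hver ν' hν'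
    have hm : Measurable fun c : (Fin t → Ω₁) × Ω₁ => p' c.1 ⬝ᵥ incr Ω₁ S t c.1 c.2 :=
      measurable_dotProduct.comp ((hp'.comp measurable_fst).prodMk hX)
    have h1 : ∀ᵐ c ∂(ν' ⊗ₘ η), 0 ≤ p' c.1 ⬝ᵥ incr Ω₁ S t c.1 c.2 := by
      refine Measure.ae_compProd_of_ae_ae (hm measurableSet_Ici) ?_
      filter_upwards [hη, hpp'] with ω h1 h2
      rw [h1, ← h2]
      exact hpos ω _ (hκP ω)
    have h2 : ∀ᵐ c ∂(ν' ⊗ₘ η), p c.1 = p' c.1 :=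
      ae_compProd_fst hpp'
    have h3 : ∀ᵐ c ∂(P.map (splitAt ht)), 0 ≤ p c.1 ⬝ᵥ incr Ω₁ S t c.1 c.2 := by
      rw [map_splitAt ht hPη]
      filter_upwards [h1, h2] with c h1 h2
      rwa [h2]
    have h4 : ∀ᵐ ω ∂P, 0 ≤ gain Ω₁ S H T le_rfl ω := by
      filter_upwards [ae_of_ae_map (measurable_splitAt ht).aemeasurable h3] with ω hω
      rw [gain_update ht]
      exact hω
    exact h4
  have hzero := hNA H hH 0 hpos'
  simp only [Finset.univ_eq_empty, Finset.sum_empty, add_zero] at hzero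
  obtain ⟨p', hp', hpp'⟩ := hver ν hν
  have := isProbabilityMeasure_of_mem_measFam hν
  let B : Set ((ℕ → ℕ) × ℝ) :=
    {b | ¬ ∀ᵐ x ∂(G.kernel b.1), p' (G.pt b.1) ⬝ᵥ incr Ω₁ S t (G.pt b.1) x = 0}
  have hB : MeasurableSet B := by
    have hs : MeasurableSet {c : (ℕ → ℕ) × Ω₁ |
        ¬ p' (G.pt c.1) ⬝ᵥ incr Ω₁ S t (G.pt c.1) c.2 = 0} := by
      have hm : Measurable fun c : (ℕ → ℕ) × Ω₁ =>
          p' (G.pt c.1) ⬝ᵥ incr Ω₁ S t (G.pt c.1) c.2 :=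
        measurable_dotProduct.comp
          ((hp'.comp (G.continuous_pt.measurable.comp measurable_fst)).prodMk
          (hX.comp ((G.continuous_pt.measurable.comp measurable_fst).prodMk measurable_snd)))
      exact hm (measurableSet_singleton 0).compl
    have := Kernel.measurable_kernel_prodMk_left (κ := G.kernel) hs
    exact (this.comp (measurable_fst : Measurable (Prod.fst : (ℕ → ℕ) × ℝ → _)))
      (measurableSet_singleton 0).compl
  obtain ⟨κ, hκ, hκP, hκB⟩ := G.exists_selector hne hB
  obtain ⟨η, _, hη, hmem⟩ := exists_measFam_succ hν hκ hκP
  obtain ⟨P, hP, hPη⟩ := exists_extension hsel ht hmem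
  obtain ⟨N, -, hN, hN0⟩ := hzero
  have h1 : ∀ᵐ ω ∂P, gain Ω₁ S H T le_rfl ω = 0 := measure_mono_null hN (hN0 P hP)
  have hm : Measurable fun c : (Fin t → Ω₁) × Ω₁ => p' c.1 ⬝ᵥ incr Ω₁ S t c.1 c.2 :=
    measurable_dotProduct.comp ((hp'.comp measurable_fst).prodMk hX)
  have hsplit := map_splitAt ht hPη
  have h2 : ∀ᵐ ω ∂P, p (splitAt ht ω).1 = p' (splitAt ht ω).1 := by
    refine ae_of_ae_map (p := fun c : (Fin t → Ω₁) × Ω₁ => p c.1 = p' c.1)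
      (measurable_splitAt ht).aemeasurable ?_
    rw [hsplit]
    exact ae_compProd_fst hpp'
  have h3 : ∀ᵐ c ∂(ν ⊗ₘ η), p' c.1 ⬝ᵥ incr Ω₁ S t c.1 c.2 = 0 := by
    rw [← hsplit]
    refine (ae_map_iff (measurable_splitAt ht).aemeasurable (hm (measurableSet_singleton 0))).2 ?_
    filter_upwards [h1, h2] with ω h1 h2
    rw [gain_update ht] at h1
    rw [← h2]
    exact h1
  have h4 := Measure.ae_ae_of_ae_compProd h3
  refine (ae_iff (p := fun ω => ¬ ∃ P ∈ Pt t ω, ¬ ∀ᵐ x ∂(P : Measure Ω₁),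
    p ω ⬝ᵥ incr Ω₁ S t ω x = 0)).1 ?_ |> fun h => by simpa only [not_not] using h
  filter_upwards [h4, hη, hpp'] with ω h4 h5 h6
  rintro ⟨P', hP', hcon⟩
  obtain ⟨z, rfl, rfl⟩ := (G.mem_iff ω P').1 hP'
  obtain ⟨z', w', hz1, hz2, hz3⟩ := hκB z 0 (by rw [h6] at hcon; exact hcon)
  refine hz3 ?_
  rw [G.kernel_apply, hz2, hz1, ← h5]
  exact h4

theorem isPolar_of_noArbitrage [Nonempty Ω₁]
    (hne : ∀ t, t < T → ∀ ω, (Pt t ω).Nonempty)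
    (hconv : ∀ t, t < T → ∀ ω, ConvexPM (Pt t ω))
    (hgraph : ∀ t, t < T →
      AnalyticSet {p : (Fin t → Ω₁) × ProbabilityMeasure Ω₁ | p.2 ∈ Pt t p.1})
    (hS : ∀ t, t ≤ T → Measurable (S t))
    (hNA : NA Ω₁ (MeasFam Ω₁ Pt T) S (fun i : Fin 0 => i.elim0)) {t : ℕ} (ht : t < T) :
    IsPolar (MeasFam Ω₁ Pt T) (univComp (Fin T → Ω₁))
      {ω | ¬ NA1 ((fun P : ProbabilityMeasure Ω₁ => (P : Measure Ω₁)) ''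
        Pt t (restr Ω₁ t ht.le ω)) (incr Ω₁ S t (restr Ω₁ t ht.le ω))} := by
  obtain ⟨G⟩ := nonempty_graphParam (hne t ht) (hgraph t ht)
  obtain ⟨p, hp, hpos, hm, hiff⟩ := exists_measurable_arbitrage G (hne t ht) (hconv t ht)
    (measurable_incr hS ht)
  refine ⟨restr Ω₁ t ht.le ⁻¹' ⋃ n, {ω | ∃ P ∈ Pt t ω, ¬ ∀ᵐ x ∂(P : Measure Ω₁),
    p n ω ⬝ᵥ incr Ω₁ S t ω x = 0}, measurable_restr_univComp ht.le (MeasurableSet.iUnion hm),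
    fun ω hω => ?_, fun P hP => ?_⟩
  · rw [mem_preimage, mem_iUnion]
    exact (hiff _).1 hω
  · have h0 : P.map (restr Ω₁ t ht.le) (⋃ n, {ω | ∃ P ∈ Pt t ω, ¬ ∀ᵐ x ∂(P : Measure Ω₁),
        p n ω ⬝ᵥ incr Ω₁ S t ω x = 0}) = 0 :=
      measure_iUnion_null fun n => null_setOf_arbitrage hS
        (fun s hs => exists_measurable_selector (hne s hs) (hgraph s hs)) hNA ht (hne t ht) G
        (hp n) (hpos n) (map_restr_mem_measFam ht.le hP)
    exact Measure.preimage_null_of_map_null (measurable_restr _ _).aemeasurable h0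

end Local

/-! ### One-step martingale measures -/

section OneStep

variable {A : Type*} [MeasurableSpace A] [TopologicalSpace A] [PolishSpace A] [BorelSpace A]
  {E : Type*} [MeasurableSpace E] {d : ℕ}
  {X : A → E → Fin d → ℝ}

theorem measurableSet_integral_rho_eq_zero {B : Type*} [MeasurableSpace B] {η : Kernel B E}
    [IsMarkovKernel η] {Y : B → E → Fin d → ℝ} (hY : Measurable fun p : B × E => Y p.1 p.2)
    {w : B × E → ℝ} (hw : Measurable w) :
    MeasurableSet {p : B × (Fin d → ℝ) |
      ∀ i, ∫ x, w (p.1, x) * rho (p.2 ⬝ᵥ Y p.1 x) * Y p.1 x i ∂(η p.1) = 0} := by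
  have hset : {p : B × (Fin d → ℝ) |
      ∀ i, ∫ x, w (p.1, x) * rho (p.2 ⬝ᵥ Y p.1 x) * Y p.1 x i ∂(η p.1) = 0} =
      ⋂ i, {p | ∫ x, w (p.1, x) * rho (p.2 ⬝ᵥ Y p.1 x) * Y p.1 x i ∂(η p.1) = 0} := by
    ext p; simp
  rw [hset]
  refine MeasurableSet.iInter fun i => ?_
  have hb : Measurable fun c : (B × (Fin d → ℝ)) × E => (c.1.1, c.2) :=
    measurable_fst.fst.prodMk measurable_snd
  have hm : Measurable fun c : (B × (Fin d → ℝ)) × E =>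
      w (c.1.1, c.2) * rho (c.1.2 ⬝ᵥ Y c.1.1 c.2) * Y c.1.1 c.2 i :=
    ((hw.comp hb).mul (continuous_rho.measurable.comp (measurable_dotProduct.comp
      (measurable_fst.snd.prodMk (hY.comp hb))))).mul ((measurable_pi_apply i).comp (hY.comp hb))
  have := hm.stronglyMeasurable.integral_kernel_prod_right'
    (κ := η.comap (Prod.fst : B × (Fin d → ℝ) → B) measurable_fst)
  exact this.measurable (measurableSet_singleton 0)

/-- A kernel without one-period arbitrage is equivalent to a kernel of martingale measures which
integrates a prescribed function. -/
theorem exists_equivalent_martingale_kernel (hX : Measurable fun p : A × E => X p.1 p.2)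
    {ν : Measure A} [IsProbabilityMeasure ν] {η : Kernel A E} [IsMarkovKernel η]
    {f : A × E → ℝ≥0∞} (hf : Measurable f) (hfin : ∀ c, f c ≠ ∞)
    (hNA : ∀ᵐ ω ∂ν, ∀ y : Fin d → ℝ, (∀ᵐ x ∂(η ω), 0 ≤ y ⬝ᵥ X ω x) →
      ∀ᵐ x ∂(η ω), y ⬝ᵥ X ω x = 0) :
    ∃ η' : Kernel A E, IsMarkovKernel η' ∧ (∀ ω, η' ω ≪ η ω) ∧ (∀ ω, η ω ≪ η' ω) ∧
      (∀ ω, ∫⁻ x, f (ω, x) ∂(η' ω) ≠ ∞) ∧ (∀ ω i, ∫⁻ x, ‖X ω x i‖ₑ ∂(η' ω) ≠ ∞) ∧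
      ∀ᵐ ω ∂ν, ∀ i, ∫ x, X ω x i ∂(η' ω) = 0 := by
  have hXω : ∀ ω, Measurable (X ω) := fun ω => hX.comp measurable_prodMk_left
  let w : A × E → ℝ := fun c => baseWeight (X c.1 c.2) / (1 + (f c).toReal)
  have hw : Measurable w := (measurable_baseWeight.comp hX).div (hf.ennreal_toReal.const_add 1)
  have hf1 : ∀ c, 1 ≤ 1 + (f c).toReal := fun c => by
    linarith [ENNReal.toReal_nonneg (a := f c)]
  have hw0 : ∀ c, 0 < w c := fun c => div_pos (baseWeight_pos _) (one_pos.trans_le (hf1 c))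
  have hwb : ∀ c, w c ≤ baseWeight (X c.1 c.2) := fun c =>
    div_le_self (baseWeight_pos _).le (hf1 c)
  have hw1 : ∀ c, w c ≤ 1 := fun c => (hwb c).trans (baseWeight_le_one _)
  have hwX : ∀ c i, w c * |X c.1 c.2 i| ≤ 1 := fun c i =>
    (mul_le_mul_of_nonneg_right (hwb c) (abs_nonneg _)).trans (baseWeight_mul_abs_le _ i)
  have hwf : ∀ c, w c * (f c).toReal ≤ 1 := fun c => by
    have h0 := ENNReal.toReal_nonneg (a := f c)
    have h1 := baseWeight_le_one (X c.1 c.2)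
    change baseWeight (X c.1 c.2) / (1 + (f c).toReal) * (f c).toReal ≤ 1
    rw [div_mul_eq_mul_div, div_le_one (one_pos.trans_le (hf1 c))]
    nlinarith
  have hwm : ∀ ω, Measurable fun x => w (ω, x) := fun ω => hw.comp measurable_prodMk_left
  have : Nonempty A := nonempty_of_isProbabilityMeasure ν
  obtain ⟨-, σ, hσ, hσR⟩ := exists_univComp_selector
    (measurable_fst : Measurable (Prod.fst : A × (Fin d → ℝ) → A))
    (measurableSet_integral_rho_eq_zero (η := η) hX hw)
  have hya := aemeasurable_of_univComp (measurable_snd.comp hσ) ν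
  let y : A → Fin d → ℝ := hya.mk
  have hy : Measurable y := hya.measurable_mk
  have hy0 : ∀ᵐ ω ∂ν, ∀ i, ∫ x, w (ω, x) * rho (y ω ⬝ᵥ X ω x) * X ω x i ∂(η ω) = 0 := by
    filter_upwards [hNA, hya.ae_eq_mk] with ω h1 h2
    obtain ⟨v, hv⟩ := exists_integral_rho_eq_zero (hXω ω) (hwm ω) (fun x => hw0 _)
      (fun x => hw1 _) (fun x i => hwX (ω, x) i) h1
    obtain ⟨h3, h4⟩ := hσR ω ⟨(ω, v), hv, rfl⟩
    have h5 : y ω = (σ ω).2 := h2.symm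
    intro i
    have := h3 i
    rw [h4, ← h5] at this
    exact this
  let D : A → E → ℝ := fun ω x => w (ω, x) * rho (y ω ⬝ᵥ X ω x)
  have hD : Measurable fun c : A × E => D c.1 c.2 :=
    hw.mul (continuous_rho.measurable.comp
      (measurable_dotProduct.comp ((hy.comp measurable_fst).prodMk hX)))
  have hD0 : ∀ ω x, 0 < D ω x := fun ω x => mul_pos (hw0 _) (rho_pos _)
  have hDle : ∀ ω x r, 0 ≤ r → w (ω, x) * r ≤ 1 → D ω x * r ≤ 2 := fun ω x r hr h => by
    have h1 := rho_le_two (y ω ⬝ᵥ X ω x)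
    have h2 := mul_nonneg (hw0 (ω, x)).le hr
    change w (ω, x) * rho (y ω ⬝ᵥ X ω x) * r ≤ 2
    nlinarith [rho_pos (y ω ⬝ᵥ X ω x)]
  let c : A → ℝ≥0∞ := fun ω => ∫⁻ x, ENNReal.ofReal (D ω x) ∂(η ω)
  have hc : Measurable c := Measurable.lintegral_kernel_prod_right' (κ := η)
    (f := fun c : A × E => ENNReal.ofReal (D c.1 c.2)) hD.ennreal_ofReal
  have hDω : ∀ ω, Measurable fun x => ENNReal.ofReal (D ω x) := fun ω =>
    (hD.comp measurable_prodMk_left).ennreal_ofReal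
  have hc0 : ∀ ω, c ω ≠ 0 := fun ω h => by
    have h1 := (lintegral_eq_zero_iff (hDω ω)).1 h
    obtain ⟨x, hx⟩ := h1.exists
    exact absurd (ENNReal.ofReal_eq_zero.1 hx) (not_le.2 (hD0 ω x))
  have hbound : ∀ ω (r : E → ℝ), (∀ x, 0 ≤ r x) → (∀ x, w (ω, x) * r x ≤ 1) →
      ∫⁻ x, ENNReal.ofReal (D ω x) * ENNReal.ofReal (r x) ∂(η ω) ≤ 2 := fun ω r hr h => by
    calc ∫⁻ x, ENNReal.ofReal (D ω x) * ENNReal.ofReal (r x) ∂(η ω) ≤ ∫⁻ _, 2 ∂(η ω) := by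
          refine lintegral_mono fun x => ?_
          rw [← ENNReal.ofReal_mul (hD0 ω x).le]
          exact ENNReal.ofReal_le_of_le_toReal (by simpa using hDle ω x _ (hr x) (h x))
      _ = 2 := by simp
  have hctop : ∀ ω, c ω ≠ ∞ := fun ω => by
    have := hbound ω (fun _ => 1) (fun _ => zero_le_one) (fun x => by simpa using hw1 (ω, x))
    simp only [ENNReal.ofReal_one, mul_one] at this
    exact ne_top_of_le_ne_top ENNReal.ofNat_ne_top this
  let g : A → E → ℝ≥0∞ := fun ω x => (c ω)⁻¹ * ENNReal.ofReal (D ω x)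
  have hg : Measurable (Function.uncurry g) :=
    (hc.comp measurable_fst).inv.mul hD.ennreal_ofReal
  have hgω : ∀ ω, Measurable (g ω) := fun ω => (hDω ω).const_mul _
  have happ : ∀ ω, η.withDensity g ω = (η ω).withDensity (g ω) := fun ω =>
    Kernel.withDensity_apply η hg ω
  have hlint : ∀ ω (h : E → ℝ≥0∞), Measurable h → ∫⁻ x, h x ∂(η.withDensity g ω) =
      (c ω)⁻¹ * ∫⁻ x, ENNReal.ofReal (D ω x) * h x ∂(η ω) := fun ω h hh => by
    rw [happ, lintegral_withDensity_eq_lintegral_mul _ (hgω ω) hh]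
    simp only [g, Pi.mul_apply, mul_assoc]
    exact lintegral_const_mul _ ((hDω ω).mul hh)
  have hfinite : ∀ ω (r : E → ℝ), Measurable r → (∀ x, 0 ≤ r x) → (∀ x, w (ω, x) * r x ≤ 1) →
      ∫⁻ x, ENNReal.ofReal (r x) ∂(η.withDensity g ω) ≠ ∞ := fun ω r hrm hr h => by
    rw [hlint ω _ hrm.ennreal_ofReal]
    exact ENNReal.mul_ne_top (ENNReal.inv_ne_top.2 (hc0 ω))
      (ne_top_of_le_ne_top ENNReal.ofNat_ne_top (hbound ω r hr h))
  refine ⟨η.withDensity g, ⟨fun ω => ⟨?_⟩⟩, fun ω => ?_, fun ω => ?_, fun ω => ?_, fun ω i => ?_, ?_⟩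
  · rw [← lintegral_one, hlint ω _ measurable_const]
    simp only [mul_one]
    exact ENNReal.inv_mul_cancel (hc0 ω) (hctop ω)
  · rw [happ]
    exact withDensity_absolutelyContinuous _ _
  · rw [happ]
    refine withDensity_absolutelyContinuous' (hgω ω).aemeasurable (Eventually.of_forall fun x => ?_)
    refine mul_ne_zero (ENNReal.inv_ne_zero.2 (hctop ω)) ?_
    exact (ENNReal.ofReal_pos.2 (hD0 ω x)).ne'
  · have := hfinite ω (fun x => (f (ω, x)).toReal)
      (hf.ennreal_toReal.comp measurable_prodMk_left) (fun x => ENNReal.toReal_nonneg)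
      (fun x => hwf (ω, x))
    simpa only [ENNReal.ofReal_toReal (hfin _)] using this
  · have := hfinite ω (fun x => |X ω x i|) (((measurable_pi_apply i).comp (hXω ω)).abs)
      (fun x => abs_nonneg _) (fun x => hwX (ω, x) i)
    simpa only [Real.enorm_eq_ofReal_abs] using this
  · filter_upwards [hy0] with ω hω i
    rw [happ, integral_withDensity_eq_integral_toReal_smul (hgω ω)
      (Eventually.of_forall fun x => ENNReal.mul_lt_top
        (ENNReal.inv_lt_top.2 (pos_iff_ne_zero.2 (hc0 ω))) ENNReal.ofReal_lt_top)]
    have : ∀ x, (g ω x).toReal • X ω x i =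
        (c ω)⁻¹.toReal * (w (ω, x) * rho (y ω ⬝ᵥ X ω x) * X ω x i) := fun x => by
      simp only [g, ENNReal.toReal_mul, ENNReal.toReal_ofReal (hD0 ω x).le, smul_eq_mul]
      ring
    simp only [this]
    rw [integral_const_mul, hω i, mul_zero]

end OneStep

/-! ### Construction of martingale measures -/

section Step

variable {Ω₁ : Type} [MeasurableSpace Ω₁] [TopologicalSpace Ω₁] [PolishSpace Ω₁] [BorelSpace Ω₁]
  {T d : ℕ} {S : (t : ℕ) → (Fin t → Ω₁) → Fin d → ℝ}
  {Pt : (t : ℕ) → (Fin t → Ω₁) → Set (ProbabilityMeasure Ω₁)}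

theorem exists_dominating_step {t : ℕ} (hne : ∀ ω, (Pt t ω).Nonempty)
    (hconv : ∀ ω, ConvexPM (Pt t ω)) (G : GraphParam (Pt t))
    (hX : Measurable fun p : (Fin t → Ω₁) × Ω₁ => incr Ω₁ S t p.1 p.2)
    {ν : Measure (Fin t → Ω₁)} (hν : ν ∈ MeasFam Ω₁ Pt t)
    (hNA : ∀ᵐ ω ∂ν, NA1 ((fun P : ProbabilityMeasure Ω₁ => (P : Measure Ω₁)) '' Pt t ω)
      (incr Ω₁ S t ω))
    {κ : (Fin t → Ω₁) → ProbabilityMeasure Ω₁}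
    (hκ : Measurable[univComp (Fin t → Ω₁), borel (ProbabilityMeasure Ω₁)] κ)
    (hκP : ∀ ω, κ ω ∈ Pt t ω) :
    ∃ η : Kernel (Fin t → Ω₁) Ω₁, IsMarkovKernel η ∧
      (ν ⊗ₘ η).map (snocPath (t := t)) ∈ MeasFam Ω₁ Pt (t + 1) ∧
      (∀ᵐ ω ∂ν, (κ ω : Measure Ω₁) ≪ η ω) ∧
      ∀ᵐ ω ∂ν, ∀ y : Fin d → ℝ, (∀ᵐ x ∂(η ω), 0 ≤ y ⬝ᵥ incr Ω₁ S t ω x) →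
        ∀ᵐ x ∂(η ω), y ⬝ᵥ incr Ω₁ S t ω x = 0 := by
  have hXω : ∀ ω, Measurable (incr Ω₁ S t ω) := fun ω => hX.comp measurable_prodMk_left
  have := isProbabilityMeasure_of_mem_measFam hν
  obtain ⟨η₀, _, hη₀⟩ := exists_kernel_ae_eq ν hκ
  let Y : (ℕ → ℕ) → Ω₁ → Fin d → ℝ := fun z => incr Ω₁ S t (G.pt z)
  have hY : Measurable fun p : (ℕ → ℕ) × Ω₁ => Y p.1 p.2 :=
    hX.comp ((G.continuous_pt.measurable.comp measurable_fst).prodMk measurable_snd)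
  let w : (ℕ → ℕ) × Ω₁ → ℝ := fun p => baseWeight (Y p.1 p.2)
  have hw : Measurable w := measurable_baseWeight.comp hY
  have hB₁ : MeasurableSet {b : (ℕ → ℕ) × (Fin d → ℝ) | η₀ (G.pt b.1) ≪ G.kernel b.1} :=
    measurable_fst (Kernel.measurableSet_absolutelyContinuous
      (η₀.comap G.pt G.continuous_pt.measurable) G.kernel)
  obtain ⟨κ', hκ', hκP', hκB⟩ := G.exists_selector hne
    (hB₁.inter (measurableSet_integral_rho_eq_zero (η := G.kernel) hY hw))
  obtain ⟨η, hη, hηκ, hmem⟩ := exists_measFam_succ hν hκ' hκP'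
  have key : ∀ᵐ ω ∂ν, (κ ω : Measure Ω₁) ≪ η ω ∧ ∃ y : Fin d → ℝ, ∀ i,
      ∫ x, baseWeight (incr Ω₁ S t ω x) * rho (y ⬝ᵥ incr Ω₁ S t ω x) * incr Ω₁ S t ω x i ∂(η ω)
        = 0 := by
    filter_upwards [hNA, hη₀, hηκ] with ω h1 h2 h3
    obtain ⟨R, hR, hκR, hRNA⟩ := exists_dominating_noArbitrage (hXω ω) (hconv ω) (hκP ω) h1
    obtain ⟨y, hy⟩ := exists_integral_rho_eq_zero (hXω ω) (measurable_baseWeight.comp (hXω ω))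
      (fun _ => baseWeight_pos _) (fun _ => baseWeight_le_one _)
      (fun _ i => baseWeight_mul_abs_le _ i) hRNA
    obtain ⟨z, rfl, rfl⟩ := (G.mem_iff ω R).1 hR
    obtain ⟨z', y', hz, hz', hB, hB'⟩ := hκB z y ⟨by
      change η₀ (G.pt z) ≪ G.kernel z
      rw [h2]
      exact hκR, hy⟩
    have hzη : η (G.pt z) = G.kernel z' := by rw [h3, G.kernel_apply, hz']
    have hB₂ : η₀ (G.pt z') ≪ G.kernel z' := hB
    rw [hz, h2, ← hzη] at hB₂
    refine ⟨hB₂, y', fun i => ?_⟩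
    have := hB' i
    simp only [w, Y, hz, ← hzη] at this
    exact this
  refine ⟨η, hη, hmem, key.mono fun ω h => h.1, key.mono fun ω h => ?_⟩
  obtain ⟨-, y, hy⟩ := h
  exact ae_eq_zero_of_integral_rho_eq_zero (hXω ω) (measurable_baseWeight.comp (hXω ω))
    (fun _ => baseWeight_pos _) (fun _ i => baseWeight_mul_abs_le _ i) hy

theorem IsMartMeas.of_borel {Q : Measure (Fin T → Ω₁)} [IsProbabilityMeasure Q]
    (hintg : ∀ (t : ℕ) (h : t ≤ T) (i : Fin d), Integrable (fun ω => S t (restr Ω₁ t h ω) i) Q)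
    (heq : ∀ (t : ℕ) (h : t + 1 ≤ T) (i : Fin d) (A : Set (Fin t → Ω₁)), MeasurableSet A →
      ∫ ω in restr Ω₁ t ((Nat.le_succ t).trans h) ⁻¹' A, S (t + 1) (restr Ω₁ (t + 1) h ω) i ∂Q
        = ∫ ω in restr Ω₁ t ((Nat.le_succ t).trans h) ⁻¹' A,
          S t (restr Ω₁ t ((Nat.le_succ t).trans h) ω) i ∂Q) : IsMartMeas Ω₁ S Q := by
  refine ⟨hintg, fun t h i A hA => ?_⟩
  obtain ⟨A', hA', rfl⟩ := hA
  have hr := measurable_restr (Ω₁ := Ω₁) t ((Nat.le_succ t).trans h)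
  obtain ⟨A'', -, hA'', hae⟩ := (hA' (Q.map (restr Ω₁ t ((Nat.le_succ t).trans h)))
    (Measure.isProbabilityMeasure_map hr.aemeasurable)).exists_measurable_superset_ae_eq
  have hae' : restr Ω₁ t ((Nat.le_succ t).trans h) ⁻¹' A'' =ᵐ[Q]
      restr Ω₁ t ((Nat.le_succ t).trans h) ⁻¹' A' := ae_of_ae_map hr.aemeasurable hae
  rw [← setIntegral_congr_set hae', ← setIntegral_congr_set hae']
  exact heq t h i A'' hA''

theorem IsMartMeas.snoc {t : ℕ} (ht : t < T) (hS : ∀ t, t ≤ T → Measurable (S t))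
    {Q : Measure (Fin t → Ω₁)} [IsProbabilityMeasure Q] (hQ : IsMartMeas Ω₁ S Q)
    {η : Kernel (Fin t → Ω₁) Ω₁} [IsMarkovKernel η]
    (hintg : ∀ i, Integrable (fun c : (Fin t → Ω₁) × Ω₁ => incr Ω₁ S t c.1 c.2 i) (Q ⊗ₘ η))
    (hmean : ∀ᵐ ω ∂Q, ∀ i, ∫ x, incr Ω₁ S t ω x i ∂(η ω) = 0) :
    IsMartMeas Ω₁ S ((Q ⊗ₘ η).map (snocPath (t := t))) := by
  set Q' := (Q ⊗ₘ η).map (snocPath (t := t)) with hQ'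
  have hQ'p : IsProbabilityMeasure Q' :=
    Measure.isProbabilityMeasure_map measurable_snocPath.aemeasurable
  have hmap : Q'.map (restr Ω₁ t t.le_succ) = Q := map_restr_compProd Q η
  have hr := measurable_restr (Ω₁ := Ω₁) t t.le_succ
  have hSi : ∀ s (hs : s ≤ T) (i : Fin d), Measurable fun ω => S s ω i := fun s hs i =>
    (measurable_pi_apply i).comp (hS s hs)
  have hSr : ∀ s (hs : s ≤ t) (i : Fin d), Measurable fun ω => S s (restr Ω₁ s hs ω) i :=
    fun s hs i => (hSi s (hs.trans ht.le) i).comp (measurable_restr s hs)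
  have hpast : ∀ s (hs : s ≤ t) (i : Fin d),
      Integrable (fun ω => S s (restr Ω₁ s (hs.trans t.le_succ) ω) i) Q' := fun s hs i => by
    have := hQ.1 s hs i
    rw [← hmap, integrable_map_measure (hSr s hs i).aestronglyMeasurable hr.aemeasurable] at this
    exact this
  have hm : ∀ i, Measurable fun ω : Fin (t + 1) → Ω₁ =>
      S (t + 1) ω i - S t (restr Ω₁ t t.le_succ ω) i := fun i =>
    (hSi (t + 1) ht i).sub ((hSi t ht.le i).comp hr)
  have hinc : ∀ i, Integrable (fun ω : Fin (t + 1) → Ω₁ =>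
      S (t + 1) ω i - S t (restr Ω₁ t t.le_succ ω) i) Q' := fun i => by
    rw [hQ', integrable_map_measure (hm i).aestronglyMeasurable
      measurable_snocPath.aemeasurable]
    refine (hintg i).congr (Eventually.of_forall fun c => ?_)
    simp only [Function.comp, restr_snocPath]
    rfl
  have hintg' : ∀ s (h : s ≤ t + 1) (i : Fin d),
      Integrable (fun ω => S s (restr Ω₁ s h ω) i) Q' := fun s h i => by
    rcases Nat.le_succ_iff.1 h with h' | rfl
    · exact hpast s h' i
    · refine ((hinc i).add (hpast t le_rfl i)).congr (Eventually.of_forall fun ω => ?_)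
      simp only [Pi.add_apply, sub_add_cancel]
      rfl
  refine IsMartMeas.of_borel hintg' fun s h i A hA => ?_
  rcases (Nat.lt_succ_iff.1 h).lt_or_eq with hs | rfl
  · have hA' : MeasurableSet (restr Ω₁ s hs.le ⁻¹' A) := measurable_restr s hs.le hA
    have := hQ.2 s hs i (restr Ω₁ s hs.le ⁻¹' A) ⟨A, le_univComp _ hA, rfl⟩
    rw [← hmap, setIntegral_map hA' (hSr _ hs i).aestronglyMeasurable hr.aemeasurable,
      setIntegral_map hA' (hSr _ hs.le i).aestronglyMeasurable hr.aemeasurable] at this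
    exact this
  · rw [← sub_eq_zero, ← integral_sub (hintg' _ h i).integrableOn (hpast s le_rfl i).integrableOn]
    have h1 : ∫ ω in restr Ω₁ s s.le_succ ⁻¹' A,
        (S (s + 1) ω i - S s (restr Ω₁ s s.le_succ ω) i) ∂Q' = 0 := by
      rw [hQ', setIntegral_map (hr hA) (hm i).aestronglyMeasurable
        measurable_snocPath.aemeasurable]
      have h2 : snocPath ⁻¹' (restr Ω₁ s s.le_succ ⁻¹' A) = A ×ˢ (univ : Set Ω₁) := by
        ext c
        simp [restr_snocPath]
      have h3 : ∀ c : (Fin s → Ω₁) × Ω₁, S (s + 1) (snocPath c) i -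
          S s (restr Ω₁ s s.le_succ (snocPath c)) i = incr Ω₁ S s c.1 c.2 i := fun c => by
        rw [restr_snocPath]; rfl
      simp only [h2, h3]
      rw [Measure.setIntegral_compProd hA MeasurableSet.univ (hintg i).integrableOn]
      simp only [Measure.restrict_univ]
      rw [setIntegral_congr_ae (g := fun _ => 0) hA (hmean.mono fun ω hω _ => hω i)]
      simp
    exact h1

end Step

section Pasting

variable {Ω₁ : Type} [MeasurableSpace Ω₁] [TopologicalSpace Ω₁] [PolishSpace Ω₁] [BorelSpace Ω₁]
  {T d : ℕ} {S : (t : ℕ) → (Fin t → Ω₁) → Fin d → ℝ}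
  {Pt : (t : ℕ) → (Fin t → Ω₁) → Set (ProbabilityMeasure Ω₁)}

/-- If the failure of local no-arbitrage is polar, then local no-arbitrage holds almost surely for
every measure of the family at the earlier time. -/
theorem ae_noArbitrage_of_isPolar [Nonempty Ω₁]
    (hne : ∀ t, t < T → ∀ ω, (Pt t ω).Nonempty)
    (hconv : ∀ t, t < T → ∀ ω, ConvexPM (Pt t ω))
    (hgraph : ∀ t, t < T →
      AnalyticSet {p : (Fin t → Ω₁) × ProbabilityMeasure Ω₁ | p.2 ∈ Pt t p.1})
    (hS : ∀ t, t ≤ T → Measurable (S t)) {t : ℕ} (ht : t < T)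
    (hpolar : IsPolar (MeasFam Ω₁ Pt T) (univComp (Fin T → Ω₁))
      {ω | ¬ NA1 ((fun P : ProbabilityMeasure Ω₁ => (P : Measure Ω₁)) ''
        Pt t (restr Ω₁ t ht.le ω)) (incr Ω₁ S t (restr Ω₁ t ht.le ω))})
    {ν : Measure (Fin t → Ω₁)} (hν : ν ∈ MeasFam Ω₁ Pt t) :
    ∀ᵐ ω ∂ν, NA1 ((fun P : ProbabilityMeasure Ω₁ => (P : Measure Ω₁)) '' Pt t ω)
      (incr Ω₁ S t ω) := by
  obtain ⟨G⟩ := nonempty_graphParam (hne t ht) (hgraph t ht)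
  obtain ⟨p, -, -, hm, hiff⟩ := exists_measurable_arbitrage G (hne t ht) (hconv t ht)
    (measurable_incr hS ht)
  obtain ⟨P, hP, rfl⟩ := exists_extension
    (fun s hs => exists_measurable_selector (hne s hs) (hgraph s hs)) ht.le hν
  obtain ⟨A, -, hsub, hA⟩ := hpolar
  have hset : {ω | ¬ NA1 ((fun P : ProbabilityMeasure Ω₁ => (P : Measure Ω₁)) '' Pt t ω)
      (incr Ω₁ S t ω)} = ⋃ n, {ω | ∃ P ∈ Pt t ω, ¬ ∀ᵐ x ∂(P : Measure Ω₁),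
        p n ω ⬝ᵥ incr Ω₁ S t ω x = 0} := by
    ext ω
    rw [mem_iUnion]
    exact hiff ω
  have hmeas : MeasurableSet[univComp (Fin t → Ω₁)]
      {ω | ¬ NA1 ((fun P : ProbabilityMeasure Ω₁ => (P : Measure Ω₁)) '' Pt t ω)
        (incr Ω₁ S t ω)} := by
    rw [hset]
    exact MeasurableSet.iUnion hm
  rw [ae_iff, Measure.map_apply₀ (measurable_restr _ _).aemeasurable
    (hmeas _ (isProbabilityMeasure_of_mem_measFam hν))]
  exact measure_mono_null hsub (hA P hP)

theorem integrable_of_subsingleton {α : Type*} [MeasurableSpace α] [Subsingleton α]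
    {μ : Measure α} [IsFiniteMeasure μ] (f : α → ℝ) : Integrable f μ := by
  rcases isEmpty_or_nonempty α with h | ⟨⟨a⟩⟩
  · rw [Measure.eq_zero_of_isEmpty μ]
    exact integrable_zero_measure
  · have : f = fun _ => f a := funext fun x => by rw [Subsingleton.elim x a]
    rw [this]
    exact integrable_const _

/-- Every measure of the family is dominated by another one, equivalent martingale measures of
which exist with any prescribed finite moment. -/
theorem exists_dominating_martingale_measures [Nonempty Ω₁]
    (hne : ∀ t, t < T → ∀ ω, (Pt t ω).Nonempty)
    (hconv : ∀ t, t < T → ∀ ω, ConvexPM (Pt t ω))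
    (hgraph : ∀ t, t < T →
      AnalyticSet {p : (Fin t → Ω₁) × ProbabilityMeasure Ω₁ | p.2 ∈ Pt t p.1})
    (hS : ∀ t, t ≤ T → Measurable (S t))
    (hNA : ∀ t < T, ∀ ν ∈ MeasFam Ω₁ Pt t, ∀ᵐ ω ∂ν,
      NA1 ((fun P : ProbabilityMeasure Ω₁ => (P : Measure Ω₁)) '' Pt t ω) (incr Ω₁ S t ω))
    {t : ℕ} (ht : t ≤ T) {P : Measure (Fin t → Ω₁)} (hP : P ∈ MeasFam Ω₁ Pt t) :
    ∃ P' ∈ MeasFam Ω₁ Pt t, P ≪ P' ∧ ∀ f : (Fin t → Ω₁) → ℝ≥0∞, Measurable f → (∀ ω, f ω ≠ ∞) →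
      ∃ Q : Measure (Fin t → Ω₁), IsProbabilityMeasure Q ∧ Q ≪ P' ∧ P' ≪ Q ∧
        IsMartMeas Ω₁ S Q ∧ ∫⁻ ω, f ω ∂Q ≠ ∞ := by
  induction t with
  | zero =>
    have := isProbabilityMeasure_of_mem_measFam hP
    refine ⟨P, hP, .rfl, fun f hf hfin => ⟨P, this, .rfl, .rfl,
      ⟨fun _ _ _ => integrable_of_subsingleton _, fun _ h => by omega⟩, ?_⟩⟩
    have hc : f = fun _ => f Fin.elim0 := funext fun x => by rw [Subsingleton.elim x Fin.elim0]
    rw [hc]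
    simpa using hfin _
  | succ t ih =>
    have ht' : t < T := ht
    have hX := measurable_incr hS ht'
    obtain ⟨ν, hν, κ, hκ, hκP, hPκ⟩ := exists_kernel_of_mem_measFam_succ hP
    obtain ⟨ν', hν', hνν', hmart⟩ := ih ht'.le hν
    have := isProbabilityMeasure_of_mem_measFam hν
    have := isProbabilityMeasure_of_mem_measFam hν'
    obtain ⟨G⟩ := nonempty_graphParam (hne t ht') (hgraph t ht')
    obtain ⟨η, _, hmem, hκη, hηNA⟩ := exists_dominating_step (hne t ht') (hconv t ht') G hX hν'
      (hNA t ht' ν' hν') hκ hκP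
    refine ⟨_, hmem, ?_, fun f hf hfin => ?_⟩
    · obtain ⟨η₀, _, hη₀⟩ := exists_kernel_ae_eq ν' hκ
      rw [hPκ η₀ inferInstance (hνν'.ae_le hη₀)]
      refine (Measure.AbsolutelyContinuous.compProd hνν' ?_).map measurable_snocPath
      filter_upwards [hνν'.ae_le hη₀, hνν'.ae_le hκη] with ω h1 h2
      rwa [h1]
    · obtain ⟨η', _, hη'η, hηη', hfη', hXη', hmean⟩ := exists_equivalent_martingale_kernel hX
        (hf.comp measurable_snocPath) (fun c => hfin _) hηNA
      have hXi : ∀ i, Measurable fun c : (Fin t → Ω₁) × Ω₁ => incr Ω₁ S t c.1 c.2 i :=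
        fun i => (measurable_pi_apply i).comp hX
      have hfs : Measurable fun c : (Fin t → Ω₁) × Ω₁ => f (snocPath c) :=
        hf.comp measurable_snocPath
      have hm : Measurable fun ω => ∫⁻ x, f (snocPath (ω, x)) ∂(η' ω) :=
        hfs.lintegral_kernel_prod_right'
      have hmi : ∀ i, Measurable fun ω => ∫⁻ x, ‖incr Ω₁ S t ω x i‖ₑ ∂(η' ω) := fun i =>
        (hXi i).enorm.lintegral_kernel_prod_right'
      obtain ⟨Q, _, hQν', hν'Q, hQ, hQf⟩ := hmart
        (fun ω => ∫⁻ x, f (snocPath (ω, x)) ∂(η' ω) + ∑ i, ∫⁻ x, ‖incr Ω₁ S t ω x i‖ₑ ∂(η' ω))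
        (hm.add (Finset.measurable_fun_sum _ fun i _ => hmi i))
        (fun ω => ENNReal.add_ne_top.2 ⟨hfη' ω, ENNReal.sum_ne_top.2 fun i _ => hXη' ω i⟩)
      refine ⟨(Q ⊗ₘ η').map snocPath,
        Measure.isProbabilityMeasure_map measurable_snocPath.aemeasurable,
        (Measure.AbsolutelyContinuous.compProd hQν' (ae_of_all _ hη'η)).map measurable_snocPath,
        (Measure.AbsolutelyContinuous.compProd hν'Q (ae_of_all _ hηη')).map measurable_snocPath,
        hQ.snoc ht' hS (fun i => ⟨(hXi i).aestronglyMeasurable, ?_⟩) (hQν'.ae_le hmean), ?_⟩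
      · rw [HasFiniteIntegral, Measure.lintegral_compProd (hXi i).enorm]
        refine (lintegral_mono fun ω => ?_).trans_lt hQf.lt_top
        exact (Finset.single_le_sum (f := fun i => ∫⁻ x, ‖incr Ω₁ S t ω x i‖ₑ ∂(η' ω))
          (fun _ _ => zero_le) (Finset.mem_univ i)).trans le_add_self
      · rw [lintegral_map hf measurable_snocPath, Measure.lintegral_compProd hfs]
        exact ((lintegral_mono fun ω => le_self_add).trans_lt hQf.lt_top).ne

/-- Local no-arbitrage outside a polar set yields dominating martingale measures. -/
theorem exists_mem_QSet_of_isPolar [Nonempty Ω₁]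
    (hne : ∀ t, t < T → ∀ ω, (Pt t ω).Nonempty)
    (hconv : ∀ t, t < T → ∀ ω, ConvexPM (Pt t ω))
    (hgraph : ∀ t, t < T →
      AnalyticSet {p : (Fin t → Ω₁) × ProbabilityMeasure Ω₁ | p.2 ∈ Pt t p.1})
    (hS : ∀ t, t ≤ T → Measurable (S t))
    (hpolar : ∀ (t : ℕ) (ht : t < T), IsPolar (MeasFam Ω₁ Pt T) (univComp (Fin T → Ω₁))
      {ω | ¬ NA1 ((fun P : ProbabilityMeasure Ω₁ => (P : Measure Ω₁)) ''
        Pt t (restr Ω₁ t ht.le ω)) (incr Ω₁ S t (restr Ω₁ t ht.le ω))})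
    {P : Measure (Fin T → Ω₁)} (hP : P ∈ MeasFam Ω₁ Pt T) :
    ∃ Q ∈ QSet Ω₁ (MeasFam Ω₁ Pt T) S (fun i : Fin 0 => i.elim0), P ≪ Q := by
  obtain ⟨P', hP', hPP', h⟩ := exists_dominating_martingale_measures hne hconv hgraph hS
    (fun t ht _ hν => ae_noArbitrage_of_isPolar hne hconv hgraph hS ht (hpolar t ht) hν) le_rfl hP
  obtain ⟨Q, hQp, hQP', hP'Q, hQ, -⟩ := h 0 measurable_zero fun _ => ENNReal.zero_ne_top
  exact ⟨Q, ⟨hQp, ⟨P', hP', hQP'⟩, hQ, fun i => i.elim0⟩, hPP'.trans hP'Q⟩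

end Pasting

end BN

open BN in
/-- **Multi-period First Fundamental Theorem without options** (Theorem 4.5).
The following are equivalent: (i) `NA(𝒫)`; (ii) for every `t < T` the set of
histories at which the one-period condition `NA(𝒫_t(ω))` fails is `𝒫`-polar;
(iii) every `P ∈ 𝒫` is dominated by some martingale measure `Q ∈ 𝒬`. -/
theorem multi_period_first_fundamental_theorem
    (Ω₁ : Type) [MeasurableSpace Ω₁] [TopologicalSpace Ω₁] [PolishSpace Ω₁]
    [BorelSpace Ω₁] [Nonempty Ω₁] (T d : ℕ)
    (Pt : (t : ℕ) → (Fin t → Ω₁) → Set (ProbabilityMeasure Ω₁))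
    (hPtne : ∀ t, t < T → ∀ ω, (Pt t ω).Nonempty)
    (hPtconv : ∀ t, t < T → ∀ ω, ConvexPM (Pt t ω))
    (hPtgraph : ∀ t, t < T →
      AnalyticSet {p : (Fin t → Ω₁) × ProbabilityMeasure Ω₁ | p.2 ∈ Pt t p.1})
    (S : (t : ℕ) → (Fin t → Ω₁) → Fin d → ℝ) (hS : ∀ t, t ≤ T → Measurable (S t)) :
    (NA Ω₁ (MeasFam Ω₁ Pt T) S (fun i : Fin 0 => i.elim0) ↔
      ∀ (t : ℕ) (ht : t < T),
        IsPolar (MeasFam Ω₁ Pt T) (univComp (Fin T → Ω₁))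
          {ω : Fin T → Ω₁ | ¬ NA1
            ((fun P : ProbabilityMeasure Ω₁ => (P : Measure Ω₁)) '' Pt t (restr Ω₁ t ht.le ω))
            (incr Ω₁ S t (restr Ω₁ t ht.le ω))}) ∧
    (NA Ω₁ (MeasFam Ω₁ Pt T) S (fun i : Fin 0 => i.elim0) ↔
      ∀ P ∈ MeasFam Ω₁ Pt T,
        ∃ Q ∈ QSet Ω₁ (MeasFam Ω₁ Pt T) S (fun i : Fin 0 => i.elim0), P ≪ Q) := by
  have hpolar := fun h t ht =>
    isPolar_of_noArbitrage (T := T) (Pt := Pt) (S := S) hPtne hPtconv hPtgraph hS h (t := t) ht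
  have hdom := fun h P =>
    exists_mem_QSet_of_isPolar (Pt := Pt) (S := S) hPtne hPtconv hPtgraph hS h (P := P)
  exact ⟨⟨hpolar, fun h => noArbitrage_of_dominated hS (hdom h)⟩,
    fun h => hdom (hpolar h), fun h => noArbitrage_of_dominated hS h⟩
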